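/- Every 𝔥-weight occurring in S(𝔫)^𝔫 occurs with multiplicity one: for each ν ∈ 𝔥*, the space of 𝔥-weight vectors of weight ν in S(𝔫)^𝔫 has dimension at most 1. Moreover every 𝔥-weight ν occurring in S(𝔫)^𝔫 is a dominant weight of the form ν = Σ_{β∈ℬ} k_β β with each k_β a nonnegative integer. -/

import Mathlib

open scoped InnerProductSpace BigOperators

structure RootSystemData (V : Type*) [NormedAddCommGroup V] [InnerProductSpace ℝ V] where
  Δ : Set V
  finite : Δ.Finite
  span_top : Submodule.span ℝ Δ = ⊤
  zero_not_mem : (0 : V) ∉ Δ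
  neg_mem : ∀ α ∈ Δ, -α ∈ Δ
  reduced : ∀ α ∈ Δ, ∀ t : ℝ, t • α ∈ Δ → t = 1 ∨ t = -1
  crystal : ∀ α ∈ Δ, ∀ β ∈ Δ, ∃ n : ℤ, 2 * ⟪α, β⟫_ℝ = (n : ℝ) * ⟪β, β⟫_ℝ
  reflect_mem : ∀ α ∈ Δ, ∀ β ∈ Δ, α - (2 * ⟪α, β⟫_ℝ / ⟪β, β⟫_ℝ) • β ∈ Δ
  Pos : Set V
  pos_subset : Pos ⊆ Δ
  mem_or_neg : ∀ α ∈ Δ, α ∈ Pos ∨ -α ∈ Pos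
  not_neg_mem : ∀ α ∈ Pos, -α ∉ Pos
  pos_add : ∀ α ∈ Pos, ∀ β ∈ Pos, α + β ∈ Δ → α + β ∈ Pos

namespace RootSystemData

variable {V : Type*} [NormedAddCommGroup V] [InnerProductSpace ℝ V] (R : RootSystemData V)

/-- The set of simple roots: indecomposable positive roots. -/
def Simple : Set V := {α ∈ R.Pos | ¬ ∃ β ∈ R.Pos, ∃ γ ∈ R.Pos, α = β + γ}

/-- The support `Π(φ)` of a positive root: the simple roots needed to express `φ`. -/
def support (φ : V) : Set V := {α ∈ R.Simple | φ ∉ Submodule.span ℝ (R.Simple \ {α})}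

/-- The root subsystem `Δ(φ)`: all roots lying in the span of the support of `φ`. -/
def sub (φ : V) : Set V := {ψ ∈ R.Δ | ψ ∈ Submodule.span ℝ (R.support φ)}

/-- The positive roots `Δ(φ)₊` of the subsystem `Δ(φ)`. -/
def posSub (φ : V) : Set V := R.sub φ ∩ R.Pos

/-- `x` is a nonnegative integer combination of positive roots. -/
def NonnegComb (x : V) : Prop :=
  ∃ c : V →₀ ℕ, ↑c.support ⊆ R.Pos ∧ x = c.sum fun α n => (n : ℝ) • α

/-- `β` is the highest root of the subset `S`. -/
def IsHighest (S : Set V) (β : V) : Prop :=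
  β ∈ S ∧ β ∈ R.Pos ∧ ∀ ψ ∈ S, R.NonnegComb (β - ψ)

/-- `β` is locally high: it is the highest root of `Δ(β)`. -/
def LocallyHigh (β : V) : Prop := β ∈ R.Pos ∧ R.IsHighest (R.sub β) β

/-- `E(β) = {φ ∈ Δ(β) : (φ,β) > 0}`. -/
def E (β : V) : Set V := {φ ∈ R.sub β | 0 < ⟪φ, β⟫_ℝ}

/-- `Δ(β)° = {φ ∈ Δ(β) : (φ,β) = 0}`. -/
def orth (β : V) : Set V := {φ ∈ R.sub β | ⟪φ, β⟫_ℝ = 0}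

/-- Strong orthogonality of two roots. -/
def StronglyOrth (φ ψ : V) : Prop := φ + ψ ∉ R.Δ ∧ φ - ψ ∉ R.Δ


/-- Half the sum of the positive roots of `Δ(β)`. -/
noncomputable def rho (β : V) : V := (2⁻¹ : ℝ) • ∑ᶠ φ ∈ R.posSub β, φ

/-- The dual Coxeter number of `Δ(β)`, `⟨ρ_β, β^∨⟩ + 1`. -/
noncomputable def dualCoxeter (β : V) : ℝ := 2 * ⟪R.rho β, β⟫_ℝ / ⟪β, β⟫_ℝ + 1

end RootSystemData

/-- A finite set of vectors is irreducible if it is nonempty and admits no splitting into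
two nonempty mutually orthogonal pieces. -/
def IsIrred {V : Type*} [NormedAddCommGroup V] [InnerProductSpace ℝ V] (S : Set V) : Prop :=
  S.Nonempty ∧ ¬ ∃ A B : Set V, A ∪ B = S ∧ A ∩ B = ∅ ∧ A.Nonempty ∧ B.Nonempty ∧
    ∀ a ∈ A, ∀ b ∈ B, ⟪a, b⟫_ℝ = 0

/-- `C` is an irreducible component of `S`. -/
def IsComponent {V : Type*} [NormedAddCommGroup V] [InnerProductSpace ℝ V]
    (S C : Set V) : Prop :=
  C ⊆ S ∧ IsIrred C ∧ ∀ a ∈ C, ∀ b ∈ S \ C, ⟪a, b⟫_ℝ = 0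

/-- The reflection `s_β` in the (co)vector `β`. -/
noncomputable def reflectRoot {V : Type*} [NormedAddCommGroup V] [InnerProductSpace ℝ V]
    (β v : V) : V := v - (2 * ⟪v, β⟫_ℝ / ⟪β, β⟫_ℝ) • β

namespace RootSystemData

variable {V : Type*} [NormedAddCommGroup V] [InnerProductSpace ℝ V] (R : RootSystemData V)

/-- A chain cascade: a nonempty list whose head is the highest root of an irreducible
component of `Δ`, and each subsequent entry is the highest root of an irreducible component
of `Δ(previous)°`. -/
def IsChainCascade (l : List V) : Prop :=
  l ≠ [] ∧
  (∀ b ∈ l.head?, ∃ C, IsComponent R.Δ C ∧ R.IsHighest C b) ∧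
  l.Chain' fun γ δ => ∃ C, IsComponent (R.orth γ) C ∧ R.IsHighest C δ

/-- The cascade `ℬ` of roots: all positive roots belonging to some chain cascade. -/
def cascade : Set V := {β | ∃ l, R.IsChainCascade l ∧ β ∈ l}

/-- `l` is the chain cascade `C(φ)` associated to the positive root `φ`. -/
def IsCascadeChainOf (φ : V) (l : List V) : Prop :=
  R.IsChainCascade l ∧ (∀ β ∈ l, φ ∈ R.sub β) ∧
  (∀ β ∈ l.dropLast, ⟪φ, β⟫_ℝ = 0) ∧ ∀ β ∈ l.getLast?, 0 < ⟪φ, β⟫_ℝ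

end RootSystemData

section LieSetup

variable (V : Type*) [NormedAddCommGroup V] [InnerProductSpace ℝ V]
  (L : Type*) [LieRing L] [LieAlgebra ℂ L] [Module.Finite ℂ L]

/-- A triangular decomposition of a finite-dimensional complex semisimple Lie algebra `L`,
with Cartan subalgebra `H`, root system `Δ` (realized in the real inner product space `V`,
the inner product being the one induced by the Killing form), chosen root vectors `e φ`,
and the projection `Φ : L → 𝔫₋` with kernel `𝔟 = 𝔥 ⊕ 𝔫`. -/
structure CascadeLieData extends RootSystemData V where
  /-- the root vectors `e_φ` -/
  e : V → L
  /-- the Cartan subalgebra `𝔥` -/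
  H : LieSubalgebra ℂ L
  /-- the realization of `V` inside `𝔥*`: each `φ ∈ V` gives a functional on `𝔥` -/
  wt : V →ₗ[ℝ] (H →ₗ[ℂ] ℂ)
  wt_inj : Function.Injective wt
  e_ne : ∀ φ ∈ Δ, e φ ≠ 0
  indep : LinearIndependent ℂ fun φ : Δ => e (φ : V)
  root_vec : ∀ x : H, ∀ φ ∈ Δ, ⁅(x : L), e φ⁆ = wt φ x • e φ
  bracket_add : ∀ φ ∈ Δ, ∀ ψ ∈ Δ, φ + ψ ∈ Δ →
    ∃ c : ℂ, c ≠ 0 ∧ ⁅e φ, e ψ⁆ = c • e (φ + ψ)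
  bracket_zero : ∀ φ ∈ Δ, ∀ ψ ∈ Δ, φ + ψ ∉ Δ → φ + ψ ≠ 0 → ⁅e φ, e ψ⁆ = 0
  bracket_opp : ∀ φ ∈ Δ, ⁅e φ, e (-φ)⁆ ∈ H
  span_eq_top : H.toSubmodule ⊔ Submodule.span ℂ (e '' Δ) = ⊤
  killing_pair : ∀ φ ∈ Δ, killingForm ℂ L (e φ) (e (-φ)) ≠ 0
  killing_orth : ∀ φ ∈ Δ, ∀ ψ ∈ Δ, φ + ψ ≠ 0 → killingForm ℂ L (e φ) (e ψ) = 0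
  /-- the projection `Φ : 𝔤 → 𝔫₋` with kernel `𝔟` -/
  Φ : L →ₗ[ℂ] L
  Φ_neg : ∀ z ∈ Submodule.span ℂ (e '' (Neg.neg '' Pos)), Φ z = z
  Φ_b : ∀ z ∈ H.toSubmodule ⊔ Submodule.span ℂ (e '' Pos), Φ z = 0

end LieSetup

namespace CascadeLieData

variable {V : Type*} [NormedAddCommGroup V] [InnerProductSpace ℝ V]
  {L : Type*} [LieRing L] [LieAlgebra ℂ L] [Module.Finite ℂ L]
  (C : CascadeLieData V L)

/-- The nilradical `𝔫 = ⊕_{φ∈Δ₊} 𝔤_φ`. -/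
def nSub : Submodule ℂ L := Submodule.span ℂ (C.e '' C.Pos)

/-- The opposite nilradical `𝔫₋`. -/
def nMinus : Submodule ℂ L := Submodule.span ℂ (C.e '' (Neg.neg '' C.Pos))

/-- The Borel subalgebra `𝔟 = 𝔥 ⊕ 𝔫` (as a subspace). -/
def bSub : Submodule ℂ L := C.H.toSubmodule ⊔ C.nSub

/-- `𝔯 = span{e_β : β ∈ ℬ}`. -/
def rSub : Submodule ℂ L := Submodule.span ℂ (C.e '' C.toRootSystemData.cascade)

/-- `𝔯₋ = span{e_{−β} : β ∈ ℬ}`. -/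
def rMinus : Submodule ℂ L :=
  Submodule.span ℂ (C.e '' (Neg.neg '' C.toRootSystemData.cascade))

/-- `𝔯₋ˣ`: the elements of `𝔯₋` all of whose coefficients are nonzero. -/
def rMinusX : Set L :=
  {z | ∃ a : V → ℂ, (∀ β ∈ C.toRootSystemData.cascade, a β ≠ 0) ∧
    z = ∑ᶠ β ∈ C.toRootSystemData.cascade, a β • C.e (-β)}

/-- `𝔰 = span{e_φ : φ ∈ Δ₊ \ ℬ}`. -/
def sSub : Submodule ℂ L :=
  Submodule.span ℂ (C.e '' (C.Pos \ C.toRootSystemData.cascade))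

/-- `𝔰₋ = span{e_{−φ} : φ ∈ Δ₊ \ ℬ}`. -/
def sMinus : Submodule ℂ L :=
  Submodule.span ℂ (C.e '' (Neg.neg '' (C.Pos \ C.toRootSystemData.cascade)))

/-- `𝔰(β) = span{e_φ : φ ∈ E(β), φ ≠ β}`. -/
def sBeta (β : V) : Submodule ℂ L :=
  Submodule.span ℂ (C.e '' (C.toRootSystemData.E β \ {β}))

/-- `𝔰(−β) = span{e_{−φ} : φ ∈ E(β), φ ≠ β}`. -/
def sBetaMinus (β : V) : Submodule ℂ L :=
  Submodule.span ℂ (C.e '' (Neg.neg '' (C.toRootSystemData.E β \ {β})))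

/-- `𝔢(β) = span{e_φ : φ ∈ E(β)}`. -/
def eSub (β : V) : Submodule ℂ L := Submodule.span ℂ (C.e '' C.toRootSystemData.E β)

/-- `𝔤(β)`: the Lie subalgebra generated by the root spaces `𝔤_{±α}`, `α ∈ Π(β)`. -/
def gSub (β : V) : LieSubalgebra ℂ L :=
  LieSubalgebra.lieSpan ℂ L
    (C.e '' C.toRootSystemData.support β ∪ C.e '' (Neg.neg '' C.toRootSystemData.support β))

end CascadeLieData

namespace RootSystemData

variable {V : Type*} [NormedAddCommGroup V] [InnerProductSpace ℝ V] {R : RootSystemData V}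

lemma ne_zero {α : V} (hα : α ∈ R.Δ) : α ≠ 0 := fun h => R.zero_not_mem (h ▸ hα)

lemma inner_self_pos {α : V} (hα : α ∈ R.Δ) : 0 < ⟪α, α⟫_ℝ :=
  real_inner_self_pos.2 (R.ne_zero hα)

lemma reflect_mem_of_int {α β : V} (hα : α ∈ R.Δ) (hβ : β ∈ R.Δ) {n : ℤ}
    (h : 2 * ⟪α, β⟫_ℝ = n * ⟪β, β⟫_ℝ) : α - (n : ℝ) • β ∈ R.Δ := by
  have := R.reflect_mem α hα β hβ
  rwa [h, mul_div_cancel_right₀ _ (R.inner_self_pos hβ).ne'] at this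

lemma sub_mem_of_inner_pos {α β : V} (hα : α ∈ R.Δ) (hβ : β ∈ R.Δ)
    (h : 0 < ⟪α, β⟫_ℝ) (hne : α ≠ β) : α - β ∈ R.Δ := by
  obtain ⟨n, hn⟩ := R.crystal α hα β hβ
  obtain ⟨m, hm⟩ := R.crystal β hβ α hα
  have hαα := R.inner_self_pos hα
  have hββ := R.inner_self_pos hβ
  have hn0 : 0 < n := by
    have : (0 : ℝ) < n := by by_contra hc; nlinarith
    exact_mod_cast this
  have hm0 : 0 < m := by
    rw [real_inner_comm] at hm
    have : (0 : ℝ) < m := by by_contra hc; nlinarith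
    exact_mod_cast this
  rcases eq_or_lt_of_le (show 1 ≤ n by omega) with h1 | h1
  · simpa [← h1] using R.reflect_mem_of_int hα hβ hn
  rcases eq_or_lt_of_le (show 1 ≤ m by omega) with h2 | h2
  · have := R.neg_mem _ (R.reflect_mem_of_int hβ hα hm)
    simpa [← h2] using this
  exfalso
  have hn2 : (2 : ℝ) ≤ n := by exact_mod_cast h1
  have hm2 : (2 : ℝ) ≤ m := by exact_mod_cast h2
  rw [real_inner_comm] at hm
  have : ⟪α - β, α - β⟫_ℝ ≤ 0 := by
    rw [real_inner_sub_sub_self]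
    nlinarith
  rw [real_inner_self_nonpos] at this
  exact hne (sub_eq_zero.1 this)

lemma add_mem_of_inner_neg {α β : V} (hα : α ∈ R.Δ) (hβ : β ∈ R.Δ)
    (h : ⟪α, β⟫_ℝ < 0) (hne : α ≠ -β) : α + β ∈ R.Δ := by
  simpa using R.sub_mem_of_inner_pos hα (R.neg_mem β hβ) (by simpa using h) hne

lemma pos_ne_neg {α β : V} (hα : α ∈ R.Pos) (hβ : β ∈ R.Pos) : α ≠ -β := by
  rintro rfl
  exact R.not_neg_mem β hβ hα

lemma add_mem_pos_of_inner_neg {α β : V} (hα : α ∈ R.Pos) (hβ : β ∈ R.Pos)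
    (h : ⟪α, β⟫_ℝ < 0) : α + β ∈ R.Pos :=
  R.pos_add α hα β hβ (R.add_mem_of_inner_neg (R.pos_subset hα) (R.pos_subset hβ) h
    (pos_ne_neg hα hβ))

lemma multiset_sum_ne_zero (n : ℕ) (s : Multiset V) (hs : ∀ x ∈ s, x ∈ R.Pos)
    (hn : s.card = n + 1) : s.sum ≠ 0 := by
  induction n generalizing s with
  | zero =>
    obtain ⟨a, rfl⟩ := Multiset.card_eq_one.1 hn
    simpa using R.ne_zero (R.pos_subset (hs a (by simp)))
  | succ n ih =>
    obtain ⟨a, has⟩ := Multiset.card_pos_iff_exists_mem.1 (by omega : 0 < s.card)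
    obtain ⟨t, rfl⟩ := Multiset.exists_cons_of_mem has
    intro h0
    have ha : a ∈ R.Pos := hs a (by simp)
    obtain ⟨x, hx, hax⟩ : ∃ x ∈ t, ⟪a, x⟫_ℝ < 0 := by
      by_contra! hc
      have h1 : 0 ≤ (t.map fun x => ⟪a, x⟫_ℝ).sum :=
        Multiset.sum_nonneg (by simpa using hc)
      have h2 : ⟪a, t.sum⟫_ℝ = (t.map fun x => ⟪a, x⟫_ℝ).sum :=
        map_multiset_sum (innerₗ V a) t
      rw [Multiset.sum_cons, add_eq_zero_iff_neg_eq] at h0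
      rw [← h2, ← h0, inner_neg_right] at h1
      linarith [R.inner_self_pos (R.pos_subset ha)]
    obtain ⟨u, rfl⟩ := Multiset.exists_cons_of_mem hx
    refine ih ((a + x) ::ₘ u) ?_ (by simpa using hn) (by simpa [add_assoc] using h0)
    intro y hy
    rcases Multiset.mem_cons.1 hy with rfl | hy
    · exact add_mem_pos_of_inner_neg ha (hs x (by simp)) hax
    · exact hs y (by simp [hy])

lemma mem_closure_simple {φ : V} (hφ : φ ∈ R.Pos) : φ ∈ AddSubmonoid.closure R.Simple := by
  have : Finite R.Δ := R.finite
  let r : R.Δ → R.Δ → Prop := fun a b =>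
    ∃ s : Multiset V, s ≠ 0 ∧ (∀ x ∈ s, x ∈ R.Pos) ∧ (b : V) = a + s.sum
  have : IsTrans R.Δ r := ⟨fun a b c ⟨s, hs, hs', h⟩ ⟨t, _, ht', h'⟩ =>
    ⟨s + t, by simp [hs], fun x hx => (Multiset.mem_add.1 hx).elim (hs' x) (ht' x), by
      rw [h', h, Multiset.sum_add, add_assoc]⟩⟩
  have : Std.Irrefl r := ⟨fun a ⟨s, hs, hs', h⟩ => by
    obtain ⟨n, hn⟩ := Nat.exists_eq_succ_of_ne_zero (mt Multiset.card_eq_zero.1 hs)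
    exact multiset_sum_ne_zero n s hs' hn (by simpa using h)⟩
  have wf := Finite.wellFounded_of_trans_of_irrefl r
  suffices ∀ x : R.Δ, (x : V) ∈ R.Pos → (x : V) ∈ AddSubmonoid.closure R.Simple from
    this ⟨φ, R.pos_subset hφ⟩ hφ
  intro x
  induction x using wf.induction with
  | _ x ih =>
    intro hx
    by_cases hs : (x : V) ∈ R.Simple
    · exact AddSubmonoid.subset_closure hs
    · obtain ⟨β, hβ, γ, hγ, h⟩ : ∃ β ∈ R.Pos, ∃ γ ∈ R.Pos, (x : V) = β + γ := by
        by_contra hc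
        exact hs ⟨hx, hc⟩
      rw [h]
      refine add_mem
        (ih ⟨β, R.pos_subset hβ⟩ ⟨{γ}, by simp, by simpa using hγ, by simpa using h⟩ hβ)
        (ih ⟨γ, R.pos_subset hγ⟩ ⟨{β}, by simp, by simpa using hβ, ?_⟩ hγ)
      simpa [add_comm] using h

lemma sub_simple_mem_pos {α δ : V} (hα : α ∈ R.Simple) (hδ : δ ∈ R.Pos)
    (h : δ - α ∈ R.Δ) : δ - α ∈ R.Pos := by
  rcases R.mem_or_neg _ h with h | h
  · exact h
  · exact absurd ⟨δ, hδ, _, h, by abel⟩ hα.2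

lemma add_ne_nsmul_simple {α : V} (hα : α ∈ R.Simple) (n : ℕ) {β γ : V} (hβ : β ∈ R.Pos)
    (hγ : γ ∈ R.Pos) (hβα : β ≠ α) (hγα : γ ≠ α) : β + γ ≠ (n : ℝ) • α := by
  induction n generalizing β γ with
  | zero =>
    intro h
    exact pos_ne_neg hβ hγ (eq_neg_of_add_eq_zero_left (by simpa using h))
  | succ n ih =>
    have key : ∀ {β γ : V}, β ∈ R.Pos → γ ∈ R.Pos → β ≠ α → γ ≠ α → 0 < ⟪β, α⟫_ℝ →
        β + γ ≠ ((n + 1 : ℕ) : ℝ) • α := by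
      intro β γ hβ hγ hβα hγα hpos h
      have h1 := sub_simple_mem_pos hα hβ
        (R.sub_mem_of_inner_pos (R.pos_subset hβ) (R.pos_subset hα.1) hpos hβα)
      refine ih h1 hγ ?_ hγα ?_
      · intro h2
        have h3 : (2 : ℝ) • α ∈ R.Δ := by
          rw [two_smul]
          rw [sub_eq_iff_eq_add] at h2
          exact h2 ▸ R.pos_subset hβ
        rcases R.reduced α (R.pos_subset hα.1) 2 h3 with h | h <;> norm_num at h
      · rw [sub_add_eq_add_sub, h]
        push_cast
        rw [add_smul, one_smul, add_sub_cancel_right]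
    intro h
    have hpos : 0 < ⟪β, α⟫_ℝ + ⟪γ, α⟫_ℝ := by
      rw [← inner_add_left, h, real_inner_smul_left]
      have := R.inner_self_pos (R.pos_subset hα.1)
      positivity
    rcases lt_or_ge 0 ⟪β, α⟫_ℝ with h1 | h1
    · exact key hβ hγ hβα hγα h1 h
    · exact key hγ hβ hγα hβα (by linarith) (by rwa [add_comm])

lemma reflectRoot_simple_mem_pos {α φ : V} (hα : α ∈ R.Simple) (hφ : φ ∈ R.Pos) (hne : φ ≠ α) :
    reflectRoot α φ ∈ R.Pos := by
  have hαΔ := R.pos_subset hα.1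
  rcases R.mem_or_neg _ (R.reflect_mem φ (R.pos_subset hφ) α hαΔ) with h | h
  · exact h
  exfalso
  obtain ⟨n, hn⟩ := R.crystal φ (R.pos_subset hφ) α hαΔ
  have hα0 := R.inner_self_pos hαΔ
  rw [hn, mul_div_cancel_right₀ _ hα0.ne'] at h
  have hne' : -(φ - (n : ℝ) • α) ≠ α := by
    intro h2
    have h3 : φ = ((n : ℝ) - 1) • α := by
      rw [sub_smul, one_smul, eq_sub_iff_add_eq]; nth_rw 1 [← h2]; abel
    rcases R.reduced α hαΔ _ (h3 ▸ R.pos_subset hφ) with h | h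
    · rw [h, one_smul] at h3; exact hne h3
    · rw [h] at h3; exact pos_ne_neg hφ hα.1 (by simpa using h3)
  have hsum : φ + -(φ - (n : ℝ) • α) = (n : ℝ) • α := by abel
  rcases le_or_gt 0 n with h0 | h0
  · lift n to ℕ using h0
    exact add_ne_nsmul_simple hα n hφ h hne hne' (by simp)
  · obtain ⟨k, rfl⟩ : ∃ k : ℕ, n = -(k : ℤ) - 1 := ⟨(-n - 1).toNat, by omega⟩
    refine multiset_sum_ne_zero (R := R) (k + 2)
      (φ ::ₘ -(φ - ((-(k : ℤ) - 1 : ℤ) : ℝ) • α) ::ₘ Multiset.replicate (k + 1) α) ?_ (by simp) ?_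
    · intro x hx
      simp only [Multiset.mem_cons, Multiset.mem_replicate] at hx
      rcases hx with rfl | rfl | ⟨-, rfl⟩
      exacts [hφ, h, hα.1]
    · rw [Multiset.sum_cons, Multiset.sum_cons, ← add_assoc, hsum, Multiset.sum_replicate,
        ← Nat.cast_smul_eq_nsmul ℝ, ← add_smul]
      push_cast
      simp

lemma exists_simple_pos : ∃ ρ : V, ∀ α ∈ R.Simple, 0 < ⟪ρ, α⟫_ℝ := by
  classical
  have hfin : R.Pos.Finite := R.finite.subset R.pos_subset
  refine ⟨∑ φ ∈ hfin.toFinset, φ, fun α hα => ?_⟩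
  have hαΔ := R.pos_subset hα.1
  have hα0 := R.inner_self_pos hαΔ
  have hrr : ∀ φ : V, reflectRoot α (reflectRoot α φ) = φ := by
    intro φ
    have : ⟪reflectRoot α φ, α⟫_ℝ = - ⟪φ, α⟫_ℝ := by
      simp only [reflectRoot, inner_sub_left, real_inner_smul_left]
      field_simp
      ring
    simp only [reflectRoot] at this ⊢
    rw [this, sub_sub, ← add_smul]
    ring_nf
    simp
  have hne : ∀ φ ∈ R.Pos, φ ≠ α → reflectRoot α φ ≠ α := by
    intro φ hφ hne h
    have := hrr φ
    rw [h] at this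
    refine pos_ne_neg hφ hα.1 (this.symm.trans ?_)
    rw [reflectRoot, mul_div_cancel_right₀ _ hα0.ne', two_smul]
    abel
  have hmem : α ∈ hfin.toFinset := by simpa using hα.1
  rw [← Finset.add_sum_erase _ _ hmem, inner_add_left, sum_inner]
  have hs : ∑ φ ∈ hfin.toFinset.erase α, ⟪φ, α⟫_ℝ =
      ∑ φ ∈ hfin.toFinset.erase α, -⟪φ, α⟫_ℝ := by
    refine Finset.sum_nbij' (reflectRoot α) (reflectRoot α) ?_ ?_ ?_ ?_ ?_
    · intro φ hφ
      simp only [Finset.mem_erase, Set.Finite.mem_toFinset] at hφ ⊢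
      exact ⟨hne φ hφ.2 hφ.1, reflectRoot_simple_mem_pos hα hφ.2 hφ.1⟩
    · intro φ hφ
      simp only [Finset.mem_erase, Set.Finite.mem_toFinset] at hφ ⊢
      exact ⟨hne φ hφ.2 hφ.1, reflectRoot_simple_mem_pos hα hφ.2 hφ.1⟩
    · exact fun φ _ => hrr φ
    · exact fun φ _ => hrr φ
    · intro φ _
      simp only [reflectRoot, inner_sub_left, real_inner_smul_left]
      field_simp
      ring
  rw [Finset.sum_neg_distrib] at hs
  linarith

lemma inner_simple_nonpos {α β : V} (hα : α ∈ R.Simple) (hβ : β ∈ R.Simple) (hne : α ≠ β) :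
    ⟪α, β⟫_ℝ ≤ 0 := by
  by_contra! h
  have h1 := sub_simple_mem_pos hβ hα.1
    (R.sub_mem_of_inner_pos (R.pos_subset hα.1) (R.pos_subset hβ.1) h hne)
  exact hα.2 ⟨_, h1, β, hβ.1, by abel⟩

lemma linearIndependent_simple : LinearIndependent ℝ ((↑) : R.Simple → V) := by
  obtain ⟨ρ, hρ⟩ := R.exists_simple_pos
  refine LinearMap.BilinForm.linearIndependent_of_pairwise_le_zero (innerₗ V) ?_ (innerₗ V ρ) _
    (fun i => hρ i i.2) fun i j hij => inner_simple_nonpos i.2 j.2 (Subtype.coe_injective.ne hij)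
  intro x hx
  exact real_inner_self_pos.2 hx

lemma pos_le_span {S : Set V} {x : V} (hx : x ∈ AddSubmonoid.closure S) :
    x ∈ Submodule.span ℝ S :=
  (AddSubmonoid.closure_le (S := (Submodule.span ℝ S).toAddSubmonoid)).2 Submodule.subset_span hx

lemma span_simple : Submodule.span ℝ R.Simple = ⊤ := by
  rw [eq_top_iff, ← R.span_top, Submodule.span_le]
  intro φ hφ
  rcases R.mem_or_neg φ hφ with h | h
  · exact pos_le_span (mem_closure_simple h)
  · exact neg_mem_iff.1 (pos_le_span (mem_closure_simple h))

variable (R)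

/-- The basis of `V` given by the simple roots. -/
noncomputable def simpleBasis : Module.Basis R.Simple ℝ V :=
  Module.Basis.mk R.linearIndependent_simple (by rw [Subtype.range_coe, span_simple])

variable {R}

@[simp] lemma simpleBasis_apply (α : R.Simple) : R.simpleBasis α = α := by simp [simpleBasis]

end RootSystemData
namespace RootSystemData

variable {V : Type*} [NormedAddCommGroup V] [InnerProductSpace ℝ V] {R : RootSystemData V}

instance : Finite R.Simple := R.finite.subset fun _ h => R.pos_subset h.1

lemma repr_nonneg_of_pos {φ : V} (hφ : φ ∈ R.Pos) (α : R.Simple) :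
    0 ≤ R.simpleBasis.repr φ α := by
  classical
  have h := mem_closure_simple hφ
  clear hφ
  induction h using AddSubmonoid.closure_induction with
  | mem x hx =>
    have : x = R.simpleBasis ⟨x, hx⟩ := by simp
    rw [this, Module.Basis.repr_self, Finsupp.single_apply]
    split_ifs <;> norm_num
  | zero => simp
  | add x y _ _ hx hy => simpa using add_nonneg hx hy

lemma repr_simple (α : R.Simple) : R.simpleBasis.repr (α : V) α = 1 := by
  rw [← simpleBasis_apply, Module.Basis.repr_self, Finsupp.single_eq_same]

lemma nonnegComb_zero : R.NonnegComb 0 := ⟨0, by simp, by simp⟩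

lemma nonnegComb_of_pos {φ : V} (hφ : φ ∈ R.Pos) : R.NonnegComb φ := by
  classical
  refine ⟨Finsupp.single φ 1, ?_, by simp⟩
  intro x hx
  have := Finsupp.support_single_subset hx
  rw [Finset.mem_singleton] at this
  exact this ▸ hφ

lemma NonnegComb.add {x y : V} (hx : R.NonnegComb x) (hy : R.NonnegComb y) :
    R.NonnegComb (x + y) := by
  classical
  obtain ⟨c, hc, rfl⟩ := hx
  obtain ⟨d, hd, rfl⟩ := hy
  refine ⟨c + d, ?_, ?_⟩
  · intro z hz
    rcases Finset.mem_union.1 (Finsupp.support_add hz) with h | h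
    exacts [hc h, hd h]
  · rw [Finsupp.sum_add_index'] <;> intros <;> simp [add_smul]

lemma NonnegComb.repr_nonneg {x : V} (hx : R.NonnegComb x) (α : R.Simple) :
    0 ≤ R.simpleBasis.repr x α := by
  obtain ⟨c, hc, rfl⟩ := hx
  rw [Finsupp.sum, map_sum, Finsupp.finsetSum_apply]
  refine Finset.sum_nonneg fun φ hφ => ?_
  rw [map_smul, Finsupp.smul_apply, smul_eq_mul]
  exact mul_nonneg (Nat.cast_nonneg _) (repr_nonneg_of_pos (hc hφ) α)

lemma eq_zero_of_repr_eq_zero {x : V} (h : ∀ α, R.simpleBasis.repr x α = 0) : x = 0 :=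
  R.simpleBasis.repr.map_eq_zero_iff.1 (Finsupp.ext h)

lemma NonnegComb.eq_zero {x : V} (hx : R.NonnegComb x) (hx' : R.NonnegComb (-x)) : x = 0 := by
  refine eq_zero_of_repr_eq_zero (R := R) fun α => le_antisymm ?_ (hx.repr_nonneg α)
  simpa using hx'.repr_nonneg α

lemma not_nonnegComb_neg {φ : V} (hφ : φ ∈ R.Pos) : ¬ R.NonnegComb (-φ) := fun h =>
  ne_zero (R.pos_subset hφ) ((nonnegComb_of_pos hφ).eq_zero h)

lemma pos_of_nonnegComb {φ : V} (hφ : φ ∈ R.Δ) (h : R.NonnegComb φ) : φ ∈ R.Pos := by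
  rcases R.mem_or_neg φ hφ with h' | h'
  · exact h'
  · exact absurd (by simpa using h) (not_nonnegComb_neg h')

lemma mem_span_iff {P : Set V} (hP : P ⊆ R.Simple) {x : V} :
    x ∈ Submodule.span ℝ P ↔ ∀ α : R.Simple, R.simpleBasis.repr x α ≠ 0 → (α : V) ∈ P := by
  have : P = R.simpleBasis '' {α : R.Simple | (α : V) ∈ P} := by
    ext x
    simp only [Set.mem_image, Set.mem_ofPred_eq, simpleBasis_apply]
    exact ⟨fun h => ⟨⟨x, hP h⟩, h, rfl⟩, by rintro ⟨y, hy, rfl⟩; exact hy⟩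
  conv_lhs => rw [this]
  rw [Module.Basis.mem_span_image]
  exact ⟨fun h α hα => h (Finsupp.mem_support_iff.2 hα),
    fun h α hα => h α (Finsupp.mem_support_iff.1 hα)⟩

lemma mem_support_iff {φ : V} (α : R.Simple) :
    (α : V) ∈ R.support φ ↔ R.simpleBasis.repr φ α ≠ 0 := by
  simp only [support, Set.mem_ofPred_eq, α.2, true_and]
  rw [mem_span_iff Set.sdiff_subset]
  push Not
  constructor
  · rintro ⟨β, h, h'⟩
    have : β = α := by
      by_contra hc
      exact h' ⟨β.2, by simpa using fun h => hc (Subtype.ext h)⟩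
    exact this ▸ h
  · exact fun h => ⟨α, h, by simp⟩

lemma support_subset (φ : V) : R.support φ ⊆ R.Simple := fun _ h => h.1

lemma mem_span_support (φ : V) : φ ∈ Submodule.span ℝ (R.support φ) :=
  (mem_span_iff (support_subset φ)).2 fun α h => (mem_support_iff α).2 h

lemma inner_eq_sum [Fintype R.Simple] (x y : V) :
    ⟪x, y⟫_ℝ = ∑ α : R.Simple, R.simpleBasis.repr x α * ⟪(α : V), y⟫_ℝ := by
  conv_lhs => rw [← R.simpleBasis.sum_repr x]
  simp [sum_inner, real_inner_smul_left]

variable (R) in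
/-- The roots in the span of a set of simple roots. -/
def levi (P : Set V) : Set V := {φ ∈ R.Δ | φ ∈ Submodule.span ℝ P}

lemma levi_simple : R.levi R.Simple = R.Δ := by
  ext; simp [levi, span_simple]

lemma subset_levi {P : Set V} (hP : P ⊆ R.Simple) : P ⊆ R.levi P := fun _ h =>
  ⟨R.pos_subset (hP h).1, Submodule.subset_span h⟩

lemma support_subset_of_mem_levi {P : Set V} (hP : P ⊆ R.Simple) {φ : V} (hφ : φ ∈ R.levi P) :
    R.support φ ⊆ P := fun α hα =>
  (mem_span_iff hP).1 hφ.2 ⟨α, hα.1⟩ ((mem_support_iff ⟨α, hα.1⟩).1 hα)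

lemma neg_mem_levi {P : Set V} {φ : V} (hφ : φ ∈ R.levi P) : -φ ∈ R.levi P :=
  ⟨R.neg_mem _ hφ.1, NegMemClass.neg_mem hφ.2⟩

lemma add_mem_levi {P : Set V} {φ ψ : V} (hφ : φ ∈ R.levi P) (hψ : ψ ∈ R.levi P)
    (h : φ + ψ ∈ R.Δ) : φ + ψ ∈ R.levi P := ⟨h, add_mem hφ.2 hψ.2⟩

lemma orth_span {S : Set V} {x y : V} (hx : ∀ s ∈ S, ⟪s, x⟫_ℝ = 0)
    (hy : y ∈ Submodule.span ℝ S) : ⟪y, x⟫_ℝ = 0 := by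
  induction hy using Submodule.span_induction with
  | mem s hs => exact hx s hs
  | zero => simp
  | add a b _ _ ha hb => rw [inner_add_left, ha, hb, add_zero]
  | smul c a _ ha => rw [real_inner_smul_left, ha, mul_zero]

lemma component_eq_levi {P K : Set V} (hP : P ⊆ R.Simple) (hK : IsComponent (R.levi P) K) :
    K = R.levi (P ∩ K) := by
  classical
  have := Fintype.ofFinite R.Simple
  apply Set.Subset.antisymm
  · intro φ hφ
    have hφP := hK.1 hφ
    refine ⟨hφP.1, ?_⟩
    let y : V := ∑ α ∈ Finset.univ.filter (fun α : R.Simple => (α : V) ∈ P ∩ K),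
      R.simpleBasis.repr φ α • (α : V)
    let z : V := ∑ α ∈ Finset.univ.filter (fun α : R.Simple => (α : V) ∉ P ∩ K),
      R.simpleBasis.repr φ α • (α : V)
    have hyz : φ = y + z := by
      conv_lhs => rw [← R.simpleBasis.sum_repr φ]
      simp only [simpleBasis_apply]
      exact (Finset.sum_filter_add_sum_filter_not _ _ _).symm
    have hy : y ∈ Submodule.span ℝ (P ∩ K) := Submodule.sum_mem _ fun α hα =>
      Submodule.smul_mem _ _ (Submodule.subset_span (by simpa using hα))
    have hz : ∀ x ∈ K, ⟪x, z⟫_ℝ = 0 := by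
      intro x hx
      rw [inner_sum]
      refine Finset.sum_eq_zero fun α hα => ?_
      rw [real_inner_smul_right]
      by_cases h0 : R.simpleBasis.repr φ α = 0
      · rw [h0, zero_mul]
      · have hαP := (mem_span_iff hP).1 hφP.2 α h0
        rw [hK.2.2 x hx α ⟨subset_levi hP hαP, fun h => ?_⟩, mul_zero]
        simp only [Finset.mem_filter] at hα
        exact hα.2 ⟨hαP, h⟩
    have h1 := hz φ hφ
    rw [hyz, inner_add_left, orth_span (fun s hs => hz s hs.2) hy, zero_add,
      inner_self_eq_zero] at h1
    rw [hyz, h1, add_zero]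
    exact hy
  · intro φ hφ
    by_contra hn
    have hφP : φ ∈ R.levi P := ⟨hφ.1, Submodule.span_mono Set.inter_subset_left hφ.2⟩
    have := orth_span (fun s hs => hK.2.2 s hs.2 φ ⟨hφP, hn⟩) hφ.2
    exact ne_zero hφ.1 (inner_self_eq_zero.1 this)

lemma IsHighest.unique {S : Set V} {β β' : V} (h : R.IsHighest S β) (h' : R.IsHighest S β') :
    β = β' :=
  sub_eq_zero.1 ((h.2.2 _ h'.1).eq_zero (by simpa using h'.2.2 _ h.1))

lemma IsHighest.support_eq {P : Set V} (hP : P ⊆ R.Simple) {β : V}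
    (h : R.IsHighest (R.levi P) β) : R.support β = P := by
  classical
  apply Set.Subset.antisymm (support_subset_of_mem_levi hP h.1)
  intro α hα
  have h1 := (h.2.2 α (subset_levi hP hα)).repr_nonneg ⟨α, hP hα⟩
  have h2 := repr_simple (⟨α, hP hα⟩ : R.Simple)
  rw [map_sub, Finsupp.sub_apply] at h1
  exact (mem_support_iff ⟨α, hP hα⟩).2 (by linarith)

lemma IsHighest.sub_eq {P : Set V} (hP : P ⊆ R.Simple) {β : V}
    (h : R.IsHighest (R.levi P) β) : R.sub β = R.levi P := by
  rw [sub, h.support_eq hP, levi]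

/-- Maximal elements of a Levi subsystem pair nonnegatively with its positive roots. -/
lemma inner_nonneg_of_maximal {P : Set V} {β γ : V} (hβ : β ∈ R.levi P) (hβ' : β ∈ R.Pos)
    (h : ∀ δ ∈ R.levi P, R.NonnegComb (δ - β) → δ = β) (hγ : γ ∈ R.levi P) (hγ' : γ ∈ R.Pos) :
    0 ≤ ⟪β, γ⟫_ℝ := by
  by_contra! hneg
  have h1 := R.add_mem_of_inner_neg hβ.1 hγ.1 hneg (pos_ne_neg hβ' hγ')
  have h2 := h _ (add_mem_levi hβ hγ h1) (by simpa using nonnegComb_of_pos hγ')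
  exact ne_zero hγ.1 (by simpa using h2)

lemma IsHighest.inner_nonneg {P : Set V} {β γ : V} (h : R.IsHighest (R.levi P) β)
    (hγ : γ ∈ R.levi P) (hγ' : γ ∈ R.Pos) : 0 ≤ ⟪β, γ⟫_ℝ :=
  inner_nonneg_of_maximal h.1 h.2.1 (fun δ hδ hn =>
    sub_eq_zero.1 (hn.eq_zero (by simpa using h.2.2 δ hδ))) hγ hγ'

lemma IsHighest.orth_eq {P : Set V} (hP : P ⊆ R.Simple) {β : V}
    (h : R.IsHighest (R.levi P) β) : R.orth β = R.levi {α ∈ P | ⟪α, β⟫_ℝ = 0} := by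
  have := Fintype.ofFinite R.Simple
  have hP' : {α ∈ P | ⟪α, β⟫_ℝ = 0} ⊆ R.Simple := fun α hα => hP hα.1
  have key : ∀ φ ∈ R.levi P, φ ∈ R.Pos → ⟪φ, β⟫_ℝ = 0 →
      φ ∈ Submodule.span ℝ {α ∈ P | ⟪α, β⟫_ℝ = 0} := by
    intro φ hφ hpos h0
    rw [mem_span_iff hP']
    intro α hα
    have hαP := (mem_span_iff hP).1 hφ.2 α hα
    refine ⟨hαP, ?_⟩
    rw [inner_eq_sum (R := R), Finset.sum_eq_zero_iff_of_nonneg] at h0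
    · exact (mul_eq_zero.1 (h0 α (Finset.mem_univ _))).resolve_left hα
    · intro α _
      by_cases hα : R.simpleBasis.repr φ α = 0
      · rw [hα, zero_mul]
      · have hαP := (mem_span_iff hP).1 hφ.2 α hα
        refine mul_nonneg (repr_nonneg_of_pos hpos α) ?_
        rw [real_inner_comm]
        exact h.inner_nonneg (subset_levi hP hαP) α.2.1
  ext φ
  rw [orth, h.sub_eq hP]
  constructor
  · rintro ⟨h1, h2⟩
    refine ⟨h1.1, ?_⟩
    rcases R.mem_or_neg φ h1.1 with hp | hp
    · exact key φ h1 hp h2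
    · exact neg_mem_iff.1 (key _ (neg_mem_levi h1) hp (by rw [inner_neg_left, h2, neg_zero]))
  · intro h1
    exact ⟨⟨h1.1, Submodule.span_mono (Set.sep_subset _ _) h1.2⟩,
      orth_span (fun s hs => hs.2) h1.2⟩

lemma exists_maximal_ge {P : Set V} {ψ : V} (hψ : ψ ∈ R.levi P) :
    ∃ β ∈ R.levi P, R.NonnegComb (β - ψ) ∧
      ∀ δ ∈ R.levi P, R.NonnegComb (δ - β) → δ = β := by
  have := Fintype.ofFinite R.Simple
  let S : Set V := {x ∈ R.levi P | R.NonnegComb (x - ψ)}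
  have hS : S.Finite := R.finite.subset fun x hx => hx.1.1
  obtain ⟨β, hβ, hmax⟩ := Set.exists_max_image S (fun x => ∑ α, R.simpleBasis.repr x α) hS
    ⟨ψ, hψ, by simpa using nonnegComb_zero⟩
  refine ⟨β, hβ.1, hβ.2, fun δ hδ hn => ?_⟩
  have h1 := hmax δ ⟨hδ, by simpa using hn.add hβ.2⟩
  have h2 : ∑ α, R.simpleBasis.repr (δ - β) α = 0 := by
    refine le_antisymm ?_ (Finset.sum_nonneg fun α _ => hn.repr_nonneg α)
    simpa using h1
  rw [Finset.sum_eq_zero_iff_of_nonneg fun α _ => hn.repr_nonneg α] at h2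
  exact sub_eq_zero.1 (eq_zero_of_repr_eq_zero (R := R) fun α => h2 α (Finset.mem_univ _))

lemma pos_of_maximal {P : Set V} {β : V} (hβ : β ∈ R.levi P)
    (h : ∀ δ ∈ R.levi P, R.NonnegComb (δ - β) → δ = β) : β ∈ R.Pos := by
  refine (R.mem_or_neg β hβ.1).resolve_right fun hn => ?_
  have h1 := h _ (neg_mem_levi hβ)
    (by simpa [sub_eq_add_neg] using (nonnegComb_of_pos hn).add (nonnegComb_of_pos hn))
  exact pos_ne_neg hn hn (by rw [neg_neg]; exact h1)

lemma orth_support_of_maximal {P : Set V} (hP : P ⊆ R.Simple) {β β' : V}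
    (hβ : β ∈ R.levi P) (h : ∀ δ ∈ R.levi P, R.NonnegComb (δ - β) → δ = β)
    (hβ' : β' ∈ R.levi P) (h' : ∀ δ ∈ R.levi P, R.NonnegComb (δ - β') → δ = β')
    (hne : β ≠ β') :
    ∀ α ∈ R.support β, ⟪α, β'⟫_ℝ = 0 := by
  have := Fintype.ofFinite R.Simple
  have hp := pos_of_maximal hβ h
  have hp' := pos_of_maximal hβ' h'
  have h0 : ⟪β, β'⟫_ℝ = 0 := by
    refine le_antisymm ?_ (inner_nonneg_of_maximal hβ hp h hβ' hp')
    by_contra! hpos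
    have h1 := R.sub_mem_of_inner_pos hβ.1 hβ'.1 hpos hne
    rcases R.mem_or_neg _ h1 with h2 | h2
    · exact hne (h' _ hβ (nonnegComb_of_pos h2))
    · exact hne (h _ hβ' (by simpa using nonnegComb_of_pos h2)).symm
  intro α hα
  rw [inner_eq_sum (R := R), Finset.sum_eq_zero_iff_of_nonneg] at h0
  · exact (mul_eq_zero.1 (h0 ⟨α, hα.1⟩ (Finset.mem_univ _))).resolve_left
      ((mem_support_iff ⟨α, hα.1⟩).1 hα)
  · intro α _
    by_cases hα : R.simpleBasis.repr β α = 0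
    · rw [hα, zero_mul]
    · have hαP := (mem_span_iff hP).1 hβ.2 α hα
      refine mul_nonneg (repr_nonneg_of_pos hp α) ?_
      rw [real_inner_comm]
      exact inner_nonneg_of_maximal hβ' hp' h' (subset_levi hP hαP) α.2.1

/-- A simple root orthogonal to `β'` and outside its support is orthogonal to its support. -/
lemma orth_of_notMem_support {β' : V} (hp' : β' ∈ R.Pos) {α : V} (hα : α ∈ R.Simple)
    (h0 : ⟪α, β'⟫_ℝ = 0) (hns : α ∉ R.support β') :
    ∀ γ ∈ R.support β', ⟪γ, α⟫_ℝ = 0 := by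
  have := Fintype.ofFinite R.Simple
  intro γ hγ
  rw [real_inner_comm, inner_eq_sum (R := R), Finset.sum_eq_zero_iff_of_nonpos] at h0
  · exact (mul_eq_zero.1 (h0 ⟨γ, hγ.1⟩ (Finset.mem_univ _))).resolve_left
      ((mem_support_iff ⟨γ, hγ.1⟩).1 hγ)
  · intro δ _
    by_cases hδ : R.simpleBasis.repr β' δ = 0
    · rw [hδ, zero_mul]
    · refine mul_nonpos_of_nonneg_of_nonpos (repr_nonneg_of_pos hp' δ)
        (inner_simple_nonpos δ.2 hα ?_)
      rintro rfl
      exact hns ((mem_support_iff δ).2 hδ)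

lemma disjoint_support_of_orth {β β' : V} (hp' : β' ∈ R.Pos)
    (h1 : ∀ α ∈ R.support β, ⟪α, β'⟫_ℝ = 0) (h2 : ∀ α ∈ R.support β', ⟪α, β⟫_ℝ = 0) :
    Disjoint (R.support β) (R.support β') := by
  classical
  have := Fintype.ofFinite R.Simple
  let x : V := ∑ α ∈ Finset.univ.filter (fun α : R.Simple => (α : V) ∈ R.support β'),
    R.simpleBasis.repr β α • (α : V)
  let z : V := ∑ α ∈ Finset.univ.filter (fun α : R.Simple => (α : V) ∉ R.support β'),
    R.simpleBasis.repr β α • (α : V)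
  have hxz : β = x + z := by
    conv_lhs => rw [← R.simpleBasis.sum_repr β]
    simp only [simpleBasis_apply]
    exact (Finset.sum_filter_add_sum_filter_not _ _ _).symm
  have hx : x ∈ Submodule.span ℝ (R.support β') := Submodule.sum_mem _ fun α hα =>
    Submodule.smul_mem _ _ (Submodule.subset_span (by simpa using hα))
  have h3 : ⟪x, z⟫_ℝ = 0 := by
    refine orth_span (fun γ hγ => ?_) hx
    rw [inner_sum]
    refine Finset.sum_eq_zero fun α hα => ?_
    rw [real_inner_smul_right]
    by_cases h0 : R.simpleBasis.repr β α = 0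
    · rw [h0, zero_mul]
    · rw [orth_of_notMem_support hp' α.2 (h1 α ((mem_support_iff α).2 h0))
        (by simpa using hα) γ hγ, mul_zero]
  have h4 : ⟪x, β⟫_ℝ = 0 := orth_span h2 hx
  rw [hxz, inner_add_right, h3, add_zero, inner_self_eq_zero] at h4
  rw [Set.disjoint_left]
  intro α hα hα'
  have hz : z ∈ Submodule.span ℝ (R.Simple \ {α}) := Submodule.sum_mem _ fun γ hγ =>
    Submodule.smul_mem _ _ (Submodule.subset_span ⟨γ.2, by
      rintro rfl
      simp only [Finset.mem_filter] at hγ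
      exact hγ.2 hα'⟩)
  refine hα.2 ?_
  rwa [hxz, h4, zero_add]

lemma mem_span_support_of_le {φ β : V} (hφ : φ ∈ R.Pos) (h : R.NonnegComb (β - φ)) :
    φ ∈ Submodule.span ℝ (R.support β) := by
  rw [mem_span_iff (support_subset β)]
  intro α hα
  rw [mem_support_iff]
  have h1 := h.repr_nonneg α
  have h2 := repr_nonneg_of_pos hφ α
  rw [map_sub, Finsupp.sub_apply] at h1
  have : 0 < R.simpleBasis.repr φ α := lt_of_le_of_ne h2 hα.symm
  linarith

lemma exists_highest {P : Set V} (hP : P ⊆ R.Simple) (hirr : IsIrred (R.levi P)) :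
    ∃ β, R.IsHighest (R.levi P) β := by
  obtain ⟨ψ₀, hψ₀⟩ := hirr.1
  obtain ⟨β, hβ, -, hmax⟩ := exists_maximal_ge hψ₀
  have hp := pos_of_maximal hβ hmax
  have orth : ∀ β' ∈ R.levi P, (∀ δ ∈ R.levi P, R.NonnegComb (δ - β') → δ = β') → β' ≠ β →
      Disjoint (R.support β) (R.support β') ∧
        ∀ α ∈ R.support β, ∀ α' ∈ R.support β', ⟪α, α'⟫_ℝ = 0 := by
    intro β' hβ' hmax' hne
    have hp' := pos_of_maximal hβ' hmax'
    have h1 := orth_support_of_maximal hP hβ hmax hβ' hmax' hne.symm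
    have hd := disjoint_support_of_orth hp' h1
      (orth_support_of_maximal hP hβ' hmax' hβ hmax hne)
    refine ⟨hd, fun α hα α' hα' => ?_⟩
    rw [real_inner_comm]
    exact orth_of_notMem_support hp' hα.1 (h1 α hα) (Set.disjoint_left.1 hd hα) α' hα'
  have key : ∀ ψ ∈ R.levi P, ψ ∈ R.Pos → ψ ∉ Submodule.span ℝ (R.support β) →
      ∀ φ ∈ Submodule.span ℝ (R.support β), ⟪φ, ψ⟫_ℝ = 0 := by
    intro ψ hψ hψp hns φ hφ
    obtain ⟨β', hβ', hge, hmax'⟩ := exists_maximal_ge hψ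
    have hψ' := mem_span_support_of_le hψp hge
    have hne : β' ≠ β := by
      rintro rfl
      exact hns hψ'
    refine orth_span (fun α hα => ?_) hφ
    rw [real_inner_comm]
    refine orth_span (fun α' hα' => ?_) hψ'
    rw [real_inner_comm]
    exact (orth β' hβ' hmax' hne).2 α hα α' hα'
  have all : ∀ φ ∈ R.levi P, φ ∈ Submodule.span ℝ (R.support β) := by
    by_contra! hc
    obtain ⟨ψ, hψ, hns⟩ := hc
    refine hirr.2 ⟨{φ ∈ R.levi P | φ ∈ Submodule.span ℝ (R.support β)},
      {φ ∈ R.levi P | φ ∉ Submodule.span ℝ (R.support β)}, ?_, ?_,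
      ⟨β, hβ, mem_span_support β⟩, ⟨ψ, hψ, hns⟩, ?_⟩
    · ext φ; simp only [Set.mem_union, Set.mem_ofPred_eq]; tauto
    · ext φ; simp only [Set.mem_inter_iff, Set.mem_ofPred_eq, Set.mem_empty_iff_false]; tauto
    · rintro a ⟨-, ha⟩ b ⟨hb, hb'⟩
      rcases R.mem_or_neg b hb.1 with h | h
      · exact key b hb h hb' a ha
      · have := key (-b) (neg_mem_levi hb) h (fun h => hb' (neg_mem_iff.1 h)) a ha
        simpa using this
  refine ⟨β, hβ, hp, fun ψ hψ => ?_⟩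
  obtain ⟨β', hβ', hge, hmax'⟩ := exists_maximal_ge hψ
  by_cases hne : β' = β
  · exact hne ▸ hge
  · exfalso
    have hd := (orth β' hβ' hmax' hne).1
    have hsub : R.support β' ⊆ R.support β :=
      support_subset_of_mem_levi (support_subset β) ⟨hβ'.1, all β' hβ'⟩
    have hemp : R.support β' = ∅ := disjoint_self.1 (hd.mono_left hsub)
    have := mem_span_support (R := R) β'
    rw [hemp, Submodule.span_empty, Submodule.mem_bot] at this
    exact ne_zero hβ'.1 this

end RootSystemData

section Irreducible

variable {V : Type*} [NormedAddCommGroup V] [InnerProductSpace ℝ V] {S T K : Set V}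

lemma IsIrred.subset_component (hT : IsIrred T) (hTS : T ⊆ S) (hK : IsComponent S K)
    (hne : (T ∩ K).Nonempty) : T ⊆ K := by
  by_contra hc
  obtain ⟨x, hx, hxK⟩ := Set.not_subset.1 hc
  exact hT.2 ⟨T ∩ K, T \ K, Set.inter_union_sdiff _ _, by ext; simp; tauto, hne,
    ⟨x, hx, hxK⟩, fun a ha b hb => hK.2.2 a ha.2 b ⟨hTS hb.1, hb.2⟩⟩

lemma exists_component {ψ : V} (hψ : ψ ∈ S) : ∃ K, IsComponent S K ∧ ψ ∈ K := by
  let r : V → V → Prop := fun a b => b ∈ S ∧ ⟪a, b⟫_ℝ ≠ 0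
  refine ⟨{φ ∈ S | Relation.ReflTransGen r ψ φ}, ⟨Set.sep_subset _ _, ⟨⟨ψ, hψ, .refl⟩, ?_⟩, ?_⟩,
    hψ, .refl⟩
  · rintro ⟨A, B, hAB, hd, ⟨a, ha⟩, ⟨b, hb⟩, h⟩
    have key : ∀ A B : Set V, A ∪ B = {φ ∈ S | Relation.ReflTransGen r ψ φ} → A ∩ B = ∅ →
        (∀ a ∈ A, ∀ b ∈ B, ⟪a, b⟫_ℝ = 0) → ψ ∈ A → ∀ x ∈ B, False := by
      intro A B hAB hd h hψA x hx
      have hreach : ∀ y, Relation.ReflTransGen r ψ y → y ∈ A := by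
        intro y hy
        induction hy with
        | refl => exact hψA
        | @tail y z hy hyz ih =>
          have hz : z ∈ A ∪ B := by rw [hAB]; exact ⟨hyz.1, hy.tail hyz⟩
          exact hz.resolve_right fun hzB => hyz.2 (h _ ih _ hzB)
      have hx' : x ∈ A ∪ B := Or.inr hx
      rw [hAB] at hx'
      exact Set.notMem_empty x (hd ▸ ⟨hreach x hx'.2, hx⟩)
    have hψ' : ψ ∈ A ∪ B := by rw [hAB]; exact ⟨hψ, .refl⟩
    rcases hψ' with h1 | h1
    · exact key A B hAB hd h h1 b hb
    · exact key B A (by rw [Set.union_comm, hAB]) (by rw [Set.inter_comm, hd])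
        (fun x hx y hy => by rw [real_inner_comm]; exact h y hy x hx) h1 a ha
  · rintro a ⟨ha, ha'⟩ b ⟨hb, hb'⟩
    by_contra hne
    exact hb' ⟨hb, ha'.tail ⟨hb, hne⟩⟩

end Irreducible

namespace RootSystemData

variable {V : Type*} [NormedAddCommGroup V] [InnerProductSpace ℝ V] {R : RootSystemData V}

lemma cascade_top {K : Set V} {β : V} (hK : IsComponent R.Δ K) (hβ : R.IsHighest K β) :
    β ∈ R.cascade :=
  ⟨[β], ⟨by simp, by simpa using ⟨K, hK, hβ⟩, List.isChain_singleton _⟩, by simp⟩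

lemma cascade_step {K : Set V} {γ δ : V} (hγ : γ ∈ R.cascade) (hK : IsComponent (R.orth γ) K)
    (hδ : R.IsHighest K δ) : δ ∈ R.cascade := by
  obtain ⟨l, ⟨-, h2, h3⟩, hm⟩ := hγ
  obtain ⟨s, t, rfl⟩ := List.append_of_mem hm
  rw [List.append_cons] at h3
  refine ⟨s ++ [γ] ++ [δ], ⟨by simp, ?_, ?_⟩, by simp⟩
  · cases s <;> simpa using h2
  · exact List.isChain_append.2 ⟨(List.isChain_append.1 h3).1, List.isChain_singleton _, by
      simpa using ⟨K, hK, hδ⟩⟩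

lemma cascade_induction {p : V → Prop}
    (top : ∀ K β, IsComponent R.Δ K → R.IsHighest K β → p β)
    (step : ∀ γ K δ, γ ∈ R.cascade → p γ → IsComponent (R.orth γ) K → R.IsHighest K δ → p δ)
    {β : V} (hβ : β ∈ R.cascade) : p β := by
  suffices h : ∀ l, R.IsChainCascade l → ∀ x ∈ l, p x by
    obtain ⟨l, hl, hm⟩ := hβ
    exact h l hl β hm
  intro l
  induction l using List.reverseRecOn with
  | nil => simp
  | append_singleton l a ih =>
    rintro ⟨-, h2, h3⟩ x hx
    rcases l.eq_nil_or_concat with rfl | ⟨l', b, rfl⟩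
    · obtain ⟨K, hK, hβ⟩ := h2 a (by simp)
      have : x = a := by simpa using hx
      exact this ▸ top K a hK hβ
    · rw [List.concat_eq_append] at *
      have h4 := List.isChain_append.1 h3
      have hl' : R.IsChainCascade (l' ++ [b]) := by
        refine ⟨by simp, ?_, h4.1⟩
        cases l' <;> simpa using h2
      rcases List.mem_append.1 hx with hx | hx
      · exact ih hl' x hx
      · obtain ⟨K, hK, hδ⟩ := h4.2.2 b (by simp) a (by simp)
        have : x = a := by simpa using hx
        exact this ▸ step b K a ⟨_, hl', by simp⟩ (ih hl' b (by simp)) hK hδ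

variable (R) in
/-- The root subsystems whose components produce the elements of the cascade. -/
def CascadeStage (S : Set V) : Prop := S = R.Δ ∨ ∃ γ ∈ R.cascade, S = R.orth γ

lemma CascadeStage.mem_cascade {S K : Set V} {β : V} (hS : R.CascadeStage S)
    (hK : IsComponent S K) (hβ : R.IsHighest K β) : β ∈ R.cascade := by
  obtain rfl | ⟨γ, hγ, rfl⟩ := hS
  exacts [cascade_top hK hβ, cascade_step hγ hK hβ]

lemma cascade_eq_levi {β : V} (hβ : β ∈ R.cascade) :
    ∃ P ⊆ R.Simple, IsIrred (R.levi P) ∧ R.IsHighest (R.levi P) β := by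
  refine cascade_induction (p := fun β => ∃ P ⊆ R.Simple, IsIrred (R.levi P) ∧
    R.IsHighest (R.levi P) β) ?_ ?_ hβ
  · intro K β hK hβ
    rw [← levi_simple] at hK
    have h := component_eq_levi subset_rfl hK
    exact ⟨_, Set.inter_subset_left, h ▸ hK.2.1, h ▸ hβ⟩
  · rintro γ K δ - ⟨P, hP, -, hγ⟩ hK hδ
    rw [hγ.orth_eq hP] at hK
    have hP' : {α ∈ P | ⟪α, γ⟫_ℝ = 0} ⊆ R.Simple := fun α hα => hP hα.1
    have h := component_eq_levi hP' hK
    exact ⟨_, Set.inter_subset_left.trans hP', h ▸ hK.2.1, h ▸ hδ⟩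

lemma CascadeStage.eq_levi {S : Set V} (hS : R.CascadeStage S) :
    ∃ P ⊆ R.Simple, S = R.levi P := by
  obtain rfl | ⟨γ, hγ, rfl⟩ := hS
  · exact ⟨_, subset_rfl, levi_simple.symm⟩
  · obtain ⟨P, hP, -, hγ⟩ := cascade_eq_levi hγ
    exact ⟨_, fun α hα => hP hα.1, hγ.orth_eq hP⟩

lemma CascadeStage.sub_eq {S K : Set V} {β : V} (hS : R.CascadeStage S)
    (hK : IsComponent S K) (hβ : R.IsHighest K β) : R.sub β = K := by
  obtain ⟨P, hP, rfl⟩ := hS.eq_levi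
  have h := component_eq_levi hP hK
  rw [h] at hβ
  rw [h]
  exact hβ.sub_eq (Set.inter_subset_left.trans hP)

lemma isIrred_sub {β : V} (hβ : β ∈ R.cascade) : IsIrred (R.sub β) := by
  obtain ⟨P, hP, hirr, hβ⟩ := cascade_eq_levi hβ
  rwa [hβ.sub_eq hP]

lemma isHighest_sub {β : V} (hβ : β ∈ R.cascade) : R.IsHighest (R.sub β) β := by
  obtain ⟨P, hP, -, hβ⟩ := cascade_eq_levi hβ
  rwa [hβ.sub_eq hP]

lemma inner_nonneg_sub {β ψ : V} (hβ : β ∈ R.cascade) (hψ : ψ ∈ R.sub β) (hp : ψ ∈ R.Pos) :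
    0 ≤ ⟪ψ, β⟫_ℝ := by
  obtain ⟨P, hP, -, hβ⟩ := cascade_eq_levi hβ
  rw [hβ.sub_eq hP] at hψ
  rw [real_inner_comm]
  exact hβ.inner_nonneg hψ hp

lemma cascade_subset_pos : R.cascade ⊆ R.Pos := fun _ hβ => (isHighest_sub hβ).2.1

lemma orth_subset_sub (β : V) : R.orth β ⊆ R.sub β := Set.sep_subset _ _

lemma exists_mem_E_of_stage {S : Set V} (hS : R.CascadeStage S) {ψ : V} (hψ : ψ ∈ S)
    (hp : ψ ∈ R.Pos) : ∃ β ∈ R.cascade, ψ ∈ R.E β := by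
  induction hn : S.ncard using Nat.strong_induction_on generalizing S with
  | _ n ih =>
    obtain ⟨P, hP, hSP⟩ := hS.eq_levi
    obtain ⟨K, hK, hψK⟩ := exists_component hψ
    obtain ⟨β, hβ⟩ : ∃ β, R.IsHighest K β := by
      have hK' := hK
      rw [hSP] at hK'
      have h := component_eq_levi hP hK'
      rw [h]
      exact exists_highest (Set.inter_subset_left.trans hP) (h ▸ hK.2.1)
    have hc := hS.mem_cascade hK hβ
    have hsub := hS.sub_eq hK hβ
    have hψβ : ψ ∈ R.sub β := hsub ▸ hψK
    rcases (inner_nonneg_sub hc hψβ hp).eq_or_lt with h0 | h0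
    · have hfin : S.Finite := R.finite.subset (hSP ▸ Set.sep_subset _ _)
      refine ih _ ?_ (S := R.orth β) (Or.inr ⟨β, hc, rfl⟩) ⟨hψβ, h0.symm⟩ rfl
      rw [← hn]
      refine Set.ncard_lt_ncard ⟨(orth_subset_sub β).trans (hsub ▸ hK.1), fun h => ?_⟩ hfin
      exact (inner_self_pos (R.pos_subset (cascade_subset_pos hc))).ne'
        (h (hK.1 hβ.1)).2
    · exact ⟨β, hc, hψβ, h0⟩

lemma exists_mem_E {ψ : V} (hp : ψ ∈ R.Pos) : ∃ β ∈ R.cascade, ψ ∈ R.E β :=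
  exists_mem_E_of_stage (Or.inl rfl) (R.pos_subset hp) hp

/-- The relative position of two elements of the cascade. -/
def CascadeRel (R : RootSystemData V) (β β' : V) : Prop :=
  β' = β ∨ R.sub β' ⊆ R.orth β ∨ R.sub β ⊆ R.orth β' ∨
    ∀ a ∈ R.sub β, ∀ b ∈ R.sub β', ⟪a, b⟫_ℝ = 0

lemma eq_of_sub_eq {β β' : V} (hβ : β ∈ R.cascade) (hβ' : β' ∈ R.cascade)
    (h : R.sub β = R.sub β') : β = β' :=
  (isHighest_sub hβ).unique (h ▸ isHighest_sub hβ')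

lemma CascadeStage.cascadeRel {S K : Set V} {β β' : V} (hS : R.CascadeStage S)
    (hK : IsComponent S K) (hβ : R.IsHighest K β)
    (h : ∀ γ ∈ R.cascade, R.sub γ ⊆ S ∨ CascadeRel R β γ) (hβ' : β' ∈ R.cascade) :
    CascadeRel R β β' := by
  have hc := hS.mem_cascade hK hβ
  have hsub := hS.sub_eq hK hβ
  have key : ∀ γ ∈ R.cascade, (R.sub γ ⊆ R.sub β → CascadeRel R β γ) → CascadeRel R β γ := by
    intro γ hγ hr
    rcases h γ hγ with h1 | h1
    · by_cases hne : (R.sub γ ∩ K).Nonempty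
      · exact hr (hsub ▸ (isIrred_sub hγ).subset_component h1 hK hne)
      · exact Or.inr (Or.inr (Or.inr fun a ha b hb =>
          hK.2.2 a (hsub ▸ ha) b ⟨h1 hb, fun hbK => hne ⟨b, hb, hbK⟩⟩))
    · exact h1
  have heq : ∀ {S' K' γ}, R.CascadeStage S' → IsComponent S' K' → R.IsHighest K' γ →
      R.sub β ⊆ S' → R.sub γ ⊆ R.sub β → CascadeRel R β γ := by
    intro S' K' γ hS' hK' hγ h1 h2
    have hc' := hS'.mem_cascade hK' hγ
    have hsub' := hS'.sub_eq hK' hγ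
    refine Or.inl (eq_of_sub_eq hc' hc (h2.antisymm ?_))
    rw [hsub']
    exact (isIrred_sub hc).subset_component h1 hK' ⟨γ, h2 (isHighest_sub hc').1, hγ.1⟩
  refine cascade_induction (p := CascadeRel R β) ?_ ?_ hβ'
  · intro K' γ hK' hγ
    exact key γ (cascade_top hK' hγ) (heq (Or.inl rfl) hK' hγ (Set.sep_subset _ _))
  · intro γ K' δ hγ hr hK' hδ
    have hst : R.CascadeStage (R.orth γ) := Or.inr ⟨γ, hγ, rfl⟩
    refine key δ (cascade_step hγ hK' hδ) fun h2 => ?_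
    have h3 : R.sub δ ⊆ R.orth γ := hst.sub_eq hK' hδ ▸ hK'.1
    have h4 := h3.trans (orth_subset_sub γ)
    rcases hr with rfl | h5 | h5 | h5
    · exact Or.inr (Or.inl h3)
    · exact Or.inr (Or.inl (h4.trans h5))
    · exact heq hst hK' hδ h5 h2
    · exact Or.inr (Or.inr (Or.inr fun a ha b hb => h5 a ha b (h4 hb)))

lemma cascadeRel {β β' : V} (hβ : β ∈ R.cascade) (hβ' : β' ∈ R.cascade) :
    CascadeRel R β β' := by
  refine cascade_induction (p := fun β => ∀ β' ∈ R.cascade, CascadeRel R β β') ?_ ?_ hβ β' hβ'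
  · intro K β hK hβ β' hβ'
    exact CascadeStage.cascadeRel (Or.inl rfl) hK hβ (fun γ _ => Or.inl (Set.sep_subset _ _)) hβ'
  · intro γ K β hγ hr hK hβ β' hβ'
    have hst : R.CascadeStage (R.orth γ) := Or.inr ⟨γ, hγ, rfl⟩
    refine hst.cascadeRel hK hβ (fun γ' hγ' => ?_) hβ'
    have h3 : R.sub β ⊆ R.orth γ := hst.sub_eq hK hβ ▸ hK.1
    have h4 := h3.trans (orth_subset_sub γ)
    rcases hr γ' hγ' with rfl | h5 | h5 | h5
    · exact Or.inr (Or.inr (Or.inr (Or.inl h3)))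
    · exact Or.inl h5
    · exact Or.inr (Or.inr (Or.inr (Or.inl (h4.trans h5))))
    · exact Or.inr (Or.inr (Or.inr (Or.inr fun a ha b hb => h5 a (h4 ha) b hb)))

lemma inner_cascade {β β' : V} (hβ : β ∈ R.cascade) (hβ' : β' ∈ R.cascade) (hne : β ≠ β') :
    ⟪β, β'⟫_ℝ = 0 := by
  rcases cascadeRel hβ hβ' with h | h | h | h
  · exact absurd h.symm hne
  · rw [real_inner_comm]
    exact (h (isHighest_sub hβ').1).2
  · exact (h (isHighest_sub hβ).1).2
  · exact h _ (isHighest_sub hβ).1 _ (isHighest_sub hβ').1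

lemma eq_of_mem_E {β β' ψ : V} (hβ : β ∈ R.cascade) (hβ' : β' ∈ R.cascade)
    (h1 : ψ ∈ R.E β) (h2 : ψ ∈ R.E β') : β = β' := by
  rcases cascadeRel hβ hβ' with h | h | h | h
  · exact h.symm
  · exact absurd (h h2.1).2 h1.2.ne'
  · exact absurd (h h1.1).2 h2.2.ne'
  · exact absurd (h _ h1.1 _ h2.1) (inner_self_pos h1.1.1).ne'

lemma mem_E_of_add_mem_cascade {φ ψ : V} (hφ : φ ∈ R.Pos) (hψ : ψ ∈ R.Pos)
    (h : φ + ψ ∈ R.cascade) : ψ ∈ R.E (φ + ψ) := by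
  have hmem : ∀ {φ ψ}, φ ∈ R.Pos → ψ ∈ R.Pos → ψ ∈ R.sub (φ + ψ) := fun {φ ψ} hφ hψ =>
    ⟨R.pos_subset hψ, mem_span_support_of_le hψ (by simpa using nonnegComb_of_pos hφ)⟩
  have hψs := hmem hφ hψ
  have hφs : φ ∈ R.sub (φ + ψ) := by
    rw [add_comm]
    exact hmem hψ hφ
  refine ⟨hψs, (inner_nonneg_sub h hψs hψ).lt_of_ne fun h0 => ?_⟩
  have hβΔ := R.pos_subset (cascade_subset_pos h)
  have hr := R.reflect_mem φ hφs.1 (φ + ψ) hβΔ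
  have h1 : ⟪φ, φ + ψ⟫_ℝ = ⟪φ + ψ, φ + ψ⟫_ℝ := by
    rw [inner_add_left (x := φ) (y := ψ), ← h0, add_zero]
  rw [h1, mul_div_cancel_right₀ _ (inner_self_pos hβΔ).ne'] at hr
  have h2 : φ - (2 : ℝ) • (φ + ψ) ∈ R.sub (φ + ψ) :=
    ⟨hr, sub_mem hφs.2 (Submodule.smul_mem _ _ (mem_span_support _))⟩
  have h3 : -(φ - (2 : ℝ) • (φ + ψ)) ∈ R.sub (φ + ψ) := neg_mem_levi h2
  refine not_nonnegComb_neg hψ ?_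
  convert (isHighest_sub h).2.2 _ h3 using 1
  module

lemma exists_unique_add_mem_cascade {ψ : V} (hψ : ψ ∈ R.Pos) (hc : ψ ∉ R.cascade) :
    ∃ φ ∈ R.Pos, φ + ψ ∈ R.cascade ∧ ∀ ψ' ∈ R.Pos, φ + ψ' ∈ R.cascade → ψ' = ψ := by
  obtain ⟨β, hβ, hE⟩ := exists_mem_E hψ
  have hβΔ := R.pos_subset (cascade_subset_pos hβ)
  have hne : β ≠ ψ := fun h => hc (h ▸ hβ)
  have h1 : β - ψ ∈ R.Δ := R.sub_mem_of_inner_pos hβΔ hE.1.1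
    (by rw [real_inner_comm]; exact hE.2) hne
  have h2 := pos_of_nonnegComb h1 ((isHighest_sub hβ).2.2 ψ hE.1)
  refine ⟨β - ψ, h2, by simpa using hβ, fun ψ' hψ' hc' => ?_⟩
  have h3 : β - ψ ∈ R.E (ψ + (β - ψ)) := mem_E_of_add_mem_cascade hψ h2 (by simpa using hβ)
  have h4 : β - ψ ∈ R.E (ψ' + (β - ψ)) := mem_E_of_add_mem_cascade hψ' h2 (by rwa [add_comm])
  have h5 := eq_of_mem_E (by simpa using hβ) (by rwa [add_comm]) h3 h4
  exact (add_right_cancel h5).symm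

end RootSystemData

section PolynomialDerivations

open MvPolynomial

variable {σ : Type*}

lemma derivation_monomial_eq (D : Derivation ℂ (MvPolynomial σ ℂ) (MvPolynomial σ ℂ))
    (s : σ →₀ ℕ) (r : ℂ) :
    D (monomial s r) =
      r • s.sum fun i k => monomial (s - Finsupp.single i 1) (k : ℂ) * D (X i) := by
  have : D = mkDerivation ℂ fun i => D (X i) := derivation_ext fun i => by
    rw [mkDerivation_X]
  conv_lhs => rw [this, mkDerivation_monomial]
  rfl

lemma derivation_eq_sum_pderiv [Fintype σ]
    (D : Derivation ℂ (MvPolynomial σ ℂ) (MvPolynomial σ ℂ)) (f : MvPolynomial σ ℂ) :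
    D f = ∑ i, pderiv i f * D (X i) := by
  classical
  have hsum (g : MvPolynomial σ ℂ) :
      (∑ i, D (X i) • pderiv i) g = ∑ i, pderiv i g * D (X i) := by
    have := congrFun (map_sum (Derivation.coeFnAddMonoidHom (R := ℂ) (A := MvPolynomial σ ℂ)
      (M := MvPolynomial σ ℂ)) (fun i => D (X i) • pderiv i) Finset.univ) g
    exact this.trans ((Finset.sum_apply _ _ _).trans
      (Finset.sum_congr rfl fun i _ => mul_comm _ _))
  have : D = ∑ i, D (X i) • pderiv i := derivation_ext fun j => by
    rw [hsum, Finset.sum_eq_single j]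
    · simp
    · intro b _ hb
      simp [pderiv_X_of_ne hb.symm]
    · simp
  conv_lhs => rw [this]
  exact hsum f

/-- An element killed by enough derivations of lowering type has a monomial supported in `S`. -/
lemma exists_monomial_supported [Finite σ] {f : MvPolynomial σ ℂ} (hf : f ≠ 0) (S : Set σ)
    (h : ∀ ψ ∉ S, ∃ D : Derivation ℂ (MvPolynomial σ ℂ) (MvPolynomial σ ℂ), D f = 0 ∧
      (∃ β ∈ S, ∃ c : ℂ, c ≠ 0 ∧ D (X ψ) = c • X β) ∧
      ∀ ψ' ≠ ψ, D (X ψ') = 0 ∨ ∃ γ ∉ S, ∃ c : ℂ, D (X ψ') = c • X γ) :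
    ∃ m ∈ f.support, ∀ i ∉ S, m i = 0 := by
  classical
  have := Fintype.ofFinite σ
  let w : σ → ℕ := fun i => if i ∈ S then 0 else 1
  obtain ⟨m, hm, hmin⟩ := Finset.exists_min_image f.support (Finsupp.weight w)
    (support_nonempty.2 hf)
  refine ⟨m, hm, fun ψ hψ => ?_⟩
  by_contra hne
  obtain ⟨D, hD, ⟨β, hβ, c, hc, hDψ⟩, hD'⟩ := h ψ hψ
  set n := m - Finsupp.single ψ 1
  have hmn : n + Finsupp.single ψ 1 = m :=
    tsub_add_cancel_of_le (Finsupp.single_le_iff.2 (Nat.one_le_iff_ne_zero.2 hne))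
  have hwm : Finsupp.weight w m = Finsupp.weight w n + 1 := by
    rw [← hmn, map_add, Finsupp.weight_single]
    simp [w, hψ]
  have h1 : coeff (n + Finsupp.single β 1) (D f) = 0 := by rw [hD, coeff_zero]
  rw [derivation_eq_sum_pderiv, coeff_sum, Finset.sum_eq_single ψ] at h1
  · rw [hDψ, mul_smul_comm, coeff_smul, coeff_mul_X, coeff_pderiv, hmn] at h1
    simp only [smul_eq_mul, mul_eq_zero, hc, mem_support_iff.1 hm, false_or] at h1
    exact Nat.cast_add_one_ne_zero _ h1
  · intro i _ hi
    rcases hD' i hi with h0 | ⟨γ, hγ, c', hi'⟩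
    · rw [h0, mul_zero, coeff_zero]
    · rw [hi', mul_smul_comm, coeff_smul, coeff_mul_X']
      split_ifs with hsupp
      · rw [coeff_pderiv]
        have h2 : coeff (n + Finsupp.single β 1 - Finsupp.single γ 1 + Finsupp.single i 1) f
            = 0 := by
          by_contra h3
          have h4 := hmin _ (mem_support_iff.2 h3)
          have h5 : n + Finsupp.single β 1 - Finsupp.single γ 1 + Finsupp.single γ 1 =
              n + Finsupp.single β 1 := tsub_add_cancel_of_le
            (Finsupp.single_le_iff.2 (Nat.one_le_iff_ne_zero.2 (Finsupp.mem_support_iff.1 hsupp)))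
          have h6 := congrArg (Finsupp.weight w) h5
          have h7 : w i ≤ 1 := by simp only [w]; split_ifs <;> omega
          simp only [map_add, Finsupp.weight_single] at h4 h6 h7
          have h8 : w γ = 1 := by simp [w, hγ]
          have h9 : w β = 0 := by simp [w, hβ]
          simp only [smul_eq_mul, one_mul, h8, h9] at h4 h6
          omega
        rw [h2, zero_mul, smul_zero]
      · rw [smul_zero]
  · simp

lemma weight_tsub_single {M : Type*} [AddCommGroup M] (w : σ → M) {s : σ →₀ ℕ} {i : σ}
    (hi : i ∈ s.support) :
    Finsupp.weight w (s - Finsupp.single i 1) + w i = Finsupp.weight w s :=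
  Finsupp.weight_sub_single_add (Finsupp.mem_support_iff.1 hi)

lemma derivation_monomial_of_diagonal {D : Derivation ℂ (MvPolynomial σ ℂ) (MvPolynomial σ ℂ)}
    {l : σ → ℂ} (hD : ∀ i, D (X i) = l i • X i) (s : σ →₀ ℕ) (r : ℂ) :
    D (monomial s r) = Finsupp.weight l s • monomial s r := by
  rw [derivation_monomial_eq, Finsupp.weight_apply, Finsupp.sum, Finsupp.sum, Finset.smul_sum,
    Finset.sum_smul]
  refine Finset.sum_congr rfl fun i hi => ?_
  have hle : Finsupp.single i 1 ≤ s :=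
    Finsupp.single_le_iff.2 (Nat.one_le_iff_ne_zero.2 (Finsupp.mem_support_iff.1 hi))
  rw [hD, mul_smul_comm, ← pow_one (X i), X_pow_eq_monomial, monomial_mul,
    tsub_add_cancel_of_le hle, smul_monomial, smul_monomial, smul_monomial]
  congr 1
  simp only [smul_eq_mul, nsmul_eq_mul]
  ring

lemma coeff_derivation_of_diagonal {D : Derivation ℂ (MvPolynomial σ ℂ) (MvPolynomial σ ℂ)}
    {l : σ → ℂ} (hD : ∀ i, D (X i) = l i • X i) (f : MvPolynomial σ ℂ) (m : σ →₀ ℕ) :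
    coeff m (D f) = Finsupp.weight l m * coeff m f := by
  induction f using MvPolynomial.induction_on' with
  | monomial s r =>
    classical
    rw [derivation_monomial_of_diagonal hD, coeff_smul, coeff_monomial]
    split_ifs with h
    · rw [h, smul_eq_mul]
    · simp
  | add p q hp hq => rw [map_add, coeff_add, hp, hq, coeff_add, mul_add]

variable {M : Type*} [AddCommGroup M] {w : σ → M} {δ : M}
  {D : Derivation ℂ (MvPolynomial σ ℂ) (MvPolynomial σ ℂ)}

lemma isWeightedHomogeneous_derivation_monomial
    (hD : ∀ i, IsWeightedHomogeneous w (D (X i)) (w i + δ)) (s : σ →₀ ℕ) (r : ℂ) :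
    IsWeightedHomogeneous w (D (monomial s r)) (Finsupp.weight w s + δ) := by
  rw [derivation_monomial_eq, Finsupp.sum, ← mem_weightedHomogeneousSubmodule ℂ]
  refine Submodule.smul_mem _ _ (Submodule.sum_mem _ fun i hi => ?_)
  have := (isWeightedHomogeneous_monomial w (s - Finsupp.single i 1) ((s i : ℕ) : ℂ) rfl).mul (hD i)
  rwa [← add_assoc, weight_tsub_single w hi] at this

lemma derivation_weightedHomogeneousComponent
    (hD : ∀ i, IsWeightedHomogeneous w (D (X i)) (w i + δ)) (n : M) (f : MvPolynomial σ ℂ) :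
    D (weightedHomogeneousComponent w n f) = weightedHomogeneousComponent w (n + δ) (D f) := by
  classical
  induction f using MvPolynomial.induction_on' with
  | monomial s r =>
    have h1 := isWeightedHomogeneous_derivation_monomial hD s r
    by_cases h : Finsupp.weight w s = n
    · subst h
      rw [h1.weightedHomogeneousComponent_same,
        (isWeightedHomogeneous_monomial w s r rfl).weightedHomogeneousComponent_same]
    · rw [h1.weightedHomogeneousComponent_ne _ (fun hc => h (add_right_cancel hc).symm),
        (isWeightedHomogeneous_monomial w s r rfl).weightedHomogeneousComponent_ne _ (Ne.symm h),
        map_zero]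
  | add p q hp hq => rw [map_add, map_add, hp, hq, map_add, map_add]

lemma isWeightedHomogeneous_derivation
    (hD : ∀ i, IsWeightedHomogeneous w (D (X i)) (w i + δ)) {f : MvPolynomial σ ℂ} {n : M}
    (hf : IsWeightedHomogeneous w f n) : IsWeightedHomogeneous w (D f) (n + δ) := by
  have h := derivation_weightedHomogeneousComponent hD n f
  rw [IsWeightedHomogeneous.weightedHomogeneousComponent_same hf] at h
  rw [h]
  exact weightedHomogeneousComponent_isWeightedHomogeneous ..

end PolynomialDerivations

namespace CascadeLieData

variable {V : Type*} [NormedAddCommGroup V] [InnerProductSpace ℝ V]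
  {L : Type*} [LieRing L] [LieAlgebra ℂ L] (C : CascadeLieData V L)

instance : Finite C.Pos := C.finite.subset C.pos_subset

lemma exists_bracket {φ ψ : V} (hφ : φ ∈ C.Δ) (hψ : ψ ∈ C.Δ) (h0 : φ + ψ ≠ 0) :
    ∃ c : ℂ, ⁅C.e φ, C.e ψ⁆ = c • C.e (φ + ψ) ∧ (φ + ψ ∉ C.Δ → c = 0) := by
  by_cases h : φ + ψ ∈ C.Δ
  · obtain ⟨c, -, hc⟩ := C.bracket_add φ hφ ψ hψ h
    exact ⟨c, hc, fun h' => absurd h h'⟩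
  · exact ⟨0, by rw [C.bracket_zero φ hφ ψ hψ h h0, zero_smul], fun _ => rfl⟩

/-- The bracket `⁅e_α, e_{-α}⁆` as an element of the Cartan subalgebra. -/
def corootVec {α : V} (hα : α ∈ C.Δ) : C.H := ⟨⁅C.e α, C.e (-α)⁆, C.bracket_opp α hα⟩

lemma corootVec_bracket {α : V} (hα : α ∈ C.Δ) (x : L) :
    ⁅(C.corootVec hα : L), x⁆ = ⁅C.e α, ⁅C.e (-α), x⁆⁆ - ⁅C.e (-α), ⁅C.e α, x⁆⁆ := by
  rw [corootVec, lie_lie]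

lemma wt_corootVec {α φ : V} (hα : α ∈ C.Δ) (hφ : φ ∈ C.Δ) :
    (⟪α, α⟫_ℝ : ℂ) * C.wt φ (C.corootVec hα) =
      (⟪φ, α⟫_ℝ : ℂ) * C.wt α (C.corootVec hα) := by
  classical
  set h := C.corootVec hα with hh
  by_cases hr : ∃ t : ℝ, φ = t • α
  · obtain ⟨t, rfl⟩ := hr
    rw [map_smul, real_inner_smul_left, LinearMap.smul_apply, Complex.real_smul]
    push_cast
    ring
  let T : Set V := {ψ ∈ C.Δ | ∃ n : ℤ, ψ = φ + (n : ℝ) • α}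
  have hT : T.Finite := C.finite.subset (Set.sep_subset _ _)
  have hTα : ∀ ψ ∈ T, ∀ t : ℝ, ψ + t • α ≠ 0 := by
    rintro ψ ⟨-, n, rfl⟩ t h0
    refine hr ⟨-(n + t), ?_⟩
    rw [neg_smul, add_smul]
    exact eq_neg_of_add_eq_zero_left (by rw [← add_assoc]; exact h0)
  have hTadd : ∀ ψ ∈ T, ψ + α ∈ C.Δ → ψ + α ∈ T := by
    rintro ψ ⟨-, n, rfl⟩ h1
    exact ⟨h1, n + 1, by push_cast; module⟩
  have hTsub : ∀ ψ, ψ + α ∈ T → ψ ∈ C.Δ → ψ ∈ T := by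
    rintro ψ ⟨-, n, hn⟩ h1
    refine ⟨h1, n - 1, ?_⟩
    rw [← add_left_inj α, hn]
    push_cast
    module
  have hα' := C.neg_mem α hα
  have hup : ∀ ψ : V, ∃ c : ℂ, ψ ∈ T →
      ⁅C.e α, C.e ψ⁆ = c • C.e (ψ + α) ∧ (ψ + α ∉ C.Δ → c = 0) := by
    intro ψ
    by_cases hψ : ψ ∈ T
    · obtain ⟨c, hc⟩ := C.exists_bracket hα hψ.1 (by simpa [add_comm] using hTα ψ hψ 1)
      rw [add_comm] at hc
      exact ⟨c, fun _ => hc⟩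
    · exact ⟨0, fun h => absurd h hψ⟩
  have hdown : ∀ ψ : V, ∃ c : ℂ, ψ ∈ T →
      ⁅C.e (-α), C.e ψ⁆ = c • C.e (ψ - α) ∧ (ψ - α ∉ C.Δ → c = 0) := by
    intro ψ
    by_cases hψ : ψ ∈ T
    · obtain ⟨c, hc⟩ := C.exists_bracket hα' hψ.1 (by simpa [add_comm] using hTα ψ hψ (-1))
      rw [neg_add_eq_sub] at hc
      exact ⟨c, fun _ => hc⟩
    · exact ⟨0, fun h => absurd h hψ⟩
  choose a ha using hup
  choose b hb using hdown
  let g : V → ℂ := fun ψ => if ψ ∈ T then b ψ * a (ψ - α) else 0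
  have hg : ∀ ψ ∈ T, C.wt ψ h = g ψ - g (ψ + α) := by
    intro ψ hψ
    have h1 : ⁅C.e α, ⁅C.e (-α), C.e ψ⁆⁆ = g ψ • C.e ψ := by
      rw [(hb ψ hψ).1, lie_smul]
      by_cases h2 : ψ - α ∈ C.Δ
      · have h3 : ψ - α ∈ T := hTsub _ (by simpa using hψ) h2
        rw [(ha _ h3).1, sub_add_cancel, smul_smul]
        simp only [g, if_pos hψ]
      · simp only [g, if_pos hψ, (hb ψ hψ).2 h2, zero_mul, zero_smul]
    have h2 : ⁅C.e (-α), ⁅C.e α, C.e ψ⁆⁆ = g (ψ + α) • C.e ψ := by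
      rw [(ha ψ hψ).1, lie_smul]
      by_cases h2 : ψ + α ∈ C.Δ
      · have h3 := hTadd ψ hψ h2
        rw [(hb _ h3).1, add_sub_cancel_right, smul_smul]
        simp only [g, if_pos h3, add_sub_cancel_right, mul_comm]
      · have h3 : ψ + α ∉ T := fun h => h2 h.1
        simp only [g, if_neg h3, (ha ψ hψ).2 h2, zero_smul]
    have h3 := C.root_vec h ψ hψ.1
    rw [hh, C.corootVec_bracket, h1, h2, ← sub_smul] at h3
    exact (smul_left_injective ℂ (C.e_ne ψ hψ.1) h3).symm
  have hs1 : Function.support g ⊆ hT.toFinset := by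
    intro ψ hψ
    rw [Set.Finite.coe_toFinset]
    by_contra hc
    exact hψ (if_neg hc)
  have hs2 : (Function.support fun ψ => g (ψ + α)) ⊆ hT.toFinset := by
    intro ψ hψ
    rw [Set.Finite.coe_toFinset]
    by_contra hc
    refine hψ ?_
    by_cases h1 : ψ + α ∈ T
    · have h2 : ψ ∉ C.Δ := fun h2 => hc (hTsub ψ h1 h2)
      simp only [g, if_pos h1, (hb _ h1).2 (by simpa using h2), zero_mul]
    · exact if_neg h1
  have hsum : ∑ ψ ∈ hT.toFinset, C.wt ψ h = 0 := by
    rw [Finset.sum_congr rfl fun ψ hψ => hg ψ (by simpa using hψ), Finset.sum_sub_distrib,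
      ← finsum_eq_sum_of_support_subset g hs1,
      ← finsum_eq_sum_of_support_subset (fun ψ => g (ψ + α)) hs2, sub_eq_zero]
    exact (finsum_comp_equiv (Equiv.addRight α)).symm
  have hsum' : ∑ ψ ∈ hT.toFinset, ⟪ψ, α⟫_ℝ = 0 := by
    have h0 := (C.inner_self_pos hα).ne'
    have hr : ∀ ψ : V, ⟪reflectRoot α ψ, α⟫_ℝ = -⟪ψ, α⟫_ℝ := by
      intro ψ
      rw [reflectRoot, inner_sub_left, real_inner_smul_left, div_mul_cancel₀ _ h0]
      ring
    refine Finset.sum_involution (fun ψ _ => reflectRoot α ψ) ?_ ?_ ?_ ?_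
    · intro ψ _
      rw [hr, add_neg_cancel]
    · intro ψ _ hne heq
      have := hr ψ
      rw [heq] at this
      exact hne (by linarith)
    · intro ψ hψ
      rw [Set.Finite.mem_toFinset] at hψ ⊢
      obtain ⟨n, hn⟩ := C.crystal ψ hψ.1 α hα
      refine ⟨C.reflect_mem ψ hψ.1 α hα, ?_⟩
      obtain ⟨k, hk⟩ := hψ.2
      refine ⟨k - n, ?_⟩
      rw [reflectRoot, hn, mul_div_cancel_right₀ _ h0, hk]
      push_cast
      module
    · intro ψ _
      rw [reflectRoot, hr, reflectRoot]
      simp [neg_div]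
  have hconst : ∀ ψ ∈ T, (⟪α, α⟫_ℝ : ℂ) * C.wt ψ h - (⟪ψ, α⟫_ℝ : ℂ) * C.wt α h =
      (⟪α, α⟫_ℝ : ℂ) * C.wt φ h - (⟪φ, α⟫_ℝ : ℂ) * C.wt α h := by
    rintro ψ ⟨-, n, rfl⟩
    rw [map_add, map_smul, LinearMap.add_apply, LinearMap.smul_apply, inner_add_left,
      real_inner_smul_left, Complex.real_smul]
    push_cast
    ring
  have hfin : ∑ ψ ∈ hT.toFinset,
      ((⟪α, α⟫_ℝ : ℂ) * C.wt ψ h - (⟪ψ, α⟫_ℝ : ℂ) * C.wt α h) = 0 := by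
    rw [Finset.sum_sub_distrib, ← Finset.mul_sum, ← Finset.sum_mul, hsum, ← Complex.ofReal_sum,
      hsum']
    simp
  rw [Finset.sum_congr rfl fun ψ hψ => hconst ψ (by simpa using hψ), Finset.sum_const,
    nsmul_eq_mul, mul_eq_zero] at hfin
  have hcard : (hT.toFinset.card : ℂ) ≠ 0 := by
    rw [Nat.cast_ne_zero]
    exact Finset.card_ne_zero.2 ⟨φ, by simpa using ⟨hφ, 0, by simp⟩⟩
  exact sub_eq_zero.1 (hfin.resolve_left hcard)

lemma wt_corootVec_self_ne_zero {α : V} (hα : α ∈ C.Δ) : C.wt α (C.corootVec hα) ≠ 0 := by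
  intro h0
  have hΔ : ∀ φ ∈ C.Δ, C.wt φ (C.corootVec hα) = 0 := by
    intro φ hφ
    have h1 := C.wt_corootVec hα hφ
    rw [h0, mul_zero, mul_eq_zero] at h1
    exact h1.resolve_left (by exact_mod_cast (C.inner_self_pos hα).ne')
  have hα' := C.neg_mem α hα
  have hcomm : ∀ x : C.H, ⁅C.e (-α), (x : L)⁆ = C.wt α x • C.e (-α) := by
    intro x
    rw [← lie_skew, C.root_vec x _ hα', map_neg, LinearMap.neg_apply, neg_smul, neg_neg]
  have had : ∀ x : L, ⁅(C.corootVec hα : L), x⁆ = 0 := by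
    intro x
    have hx : x ∈ C.H.toSubmodule ⊔ Submodule.span ℂ (C.e '' C.Δ) := by
      rw [C.span_eq_top]; trivial
    have hle : C.H.toSubmodule ⊔ Submodule.span ℂ (C.e '' C.Δ) ≤
        LinearMap.ker (LieAlgebra.ad ℂ L (C.corootVec hα : L)) := by
      rw [sup_le_iff, Submodule.span_le]
      constructor
      · intro y hy
        rw [LinearMap.mem_ker, LieAlgebra.ad_apply, C.corootVec_bracket, hcomm ⟨y, hy⟩,
          ← lie_skew (C.e α) y, C.root_vec ⟨y, hy⟩ α hα, lie_smul, lie_neg, lie_smul,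
          sub_neg_eq_add, ← smul_add, ← lie_skew, neg_add_cancel, smul_zero]
      · rintro _ ⟨φ, hφ, rfl⟩
        rw [SetLike.mem_coe, LinearMap.mem_ker, LieAlgebra.ad_apply, C.root_vec _ φ hφ,
          hΔ φ hφ, zero_smul]
    exact hle hx
  obtain ⟨x, hx⟩ : ∃ x, C.wt α x ≠ 0 := by
    by_contra! hc
    exact RootSystemData.ne_zero hα (C.wt_inj (by rw [map_zero]; exact LinearMap.ext hc))
  have h1 : killingForm ℂ L (C.corootVec hα : L) x = 0 := by
    have : LieAlgebra.ad ℂ L (C.corootVec hα : L) = 0 := LinearMap.ext had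
    rw [killingForm_apply_apply, this, LinearMap.zero_comp, map_zero]
  rw [corootVec, LieModule.traceForm_apply_lie_apply, hcomm, map_smul, smul_eq_mul] at h1
  exact mul_ne_zero hx (C.killing_pair α hα) h1

end CascadeLieData

lemma map_finsuppWeight {σ M N : Type*} [AddCommMonoid M] [AddCommMonoid N] (w : σ → M)
    (g : M →+ N) (m : σ →₀ ℕ) :
    g (Finsupp.weight w m) = Finsupp.weight (fun i => g (w i)) m := by
  simp [Finsupp.weight_apply, Finsupp.sum]

/-- A primitive vector on which a lowering operator is nilpotent has natural weight. -/
lemma exists_nat_of_primitive {W : Type*} [AddCommGroup W] [Module ℂ W] (E F : W →ₗ[ℂ] W)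
    {g : W} (hg : g ≠ 0) (hE : E g = 0) {a : ℂ}
    (hK : ∀ k : ℕ, E (F (F^[k] g)) - F (E (F^[k] g)) = (a - 2 * k) • F^[k] g)
    (hnil : ∃ N, F^[N] g = 0) : ∃ k : ℕ, a = k := by
  classical
  have key : ∀ k : ℕ, E (F (F^[k] g)) = ((k + 1) * (a - k) : ℂ) • F^[k] g := by
    intro k
    induction k with
    | zero => simpa [hE] using hK 0
    | succ k ih =>
      have h := hK (k + 1)
      rw [Function.iterate_succ_apply', ih, map_smul, sub_eq_iff_eq_add, ← add_smul] at h
      rw [Function.iterate_succ_apply', h]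
      congr 1
      push_cast
      ring
  have hpos : Nat.find hnil ≠ 0 := fun h => hg (by simpa [h] using Nat.find_spec hnil)
  obtain ⟨k, hk⟩ := Nat.exists_eq_succ_of_ne_zero hpos
  have h1 : F^[k + 1] g = 0 := by
    have := Nat.find_spec hnil
    rwa [hk] at this
  have h2 : F^[k] g ≠ 0 := Nat.find_min hnil (by omega)
  have h3 := key k
  rw [← Function.iterate_succ_apply' (f := F), h1, map_zero, eq_comm, smul_eq_zero] at h3
  rcases mul_eq_zero.1 (h3.resolve_right h2) with h4 | h4
  · exact absurd h4 (Nat.cast_add_one_ne_zero k)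
  · exact ⟨k, sub_eq_zero.1 h4⟩

lemma RootSystemData.inner_nonneg_of_simple_pos {V : Type*} [NormedAddCommGroup V]
    [InnerProductSpace ℝ V] {R : RootSystemData V} {ρ φ : V} (h : ∀ α ∈ R.Simple, 0 < ⟪ρ, α⟫_ℝ)
    (hφ : φ ∈ R.Pos) : 0 ≤ ⟪ρ, φ⟫_ℝ := by
  have hc := mem_closure_simple hφ
  clear hφ
  induction hc using AddSubmonoid.closure_induction with
  | mem x hx => exact (h x hx).le
  | zero => simp
  | add x y _ _ hx hy => rw [inner_add_right]; exact add_nonneg hx hy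

namespace CascadeLieData

open MvPolynomial RootSystemData

variable {V : Type*} [NormedAddCommGroup V] [InnerProductSpace ℝ V]
  {L : Type*} [LieRing L] [LieAlgebra ℂ L] {C : CascadeLieData V L}
  {ι : L →ₗ[ℂ] MvPolynomial (↥C.Pos) ℂ}
  {Dn : L → Derivation ℂ (MvPolynomial (↥C.Pos) ℂ) (MvPolynomial (↥C.Pos) ℂ)}
  {Dh : C.H → Derivation ℂ (MvPolynomial (↥C.Pos) ℂ) (MvPolynomial (↥C.Pos) ℂ)}

lemma e_mem_nSub {φ : V} (hφ : φ ∈ C.Pos) : C.e φ ∈ C.nSub :=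
  Submodule.subset_span ⟨φ, hφ, rfl⟩

lemma dn_X
    (hι : ∀ φ : C.Pos, ι (C.e φ) = X φ)
    (hDn : ∀ v ∈ C.nSub, ∀ w ∈ C.nSub, Dn v (ι w) = ι ⁅v, w⁆)
    {φ : V} (hφ : φ ∈ C.Pos) (ψ : C.Pos) :
    Dn (C.e φ) (X ψ) = 0 ∧ φ + ψ ∉ C.Δ ∨
      ∃ h : φ + ψ ∈ C.Pos, ∃ c : ℂ, c ≠ 0 ∧ Dn (C.e φ) (X ψ) = c • X ⟨φ + ψ, h⟩ := by
  rw [← hι, hDn _ (e_mem_nSub hφ) _ (e_mem_nSub ψ.2)]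
  have hφ' := C.pos_subset hφ
  have hψ' := C.pos_subset ψ.2
  by_cases h : φ + ψ ∈ C.Δ
  · obtain ⟨c, hc, hc'⟩ := C.bracket_add φ hφ' ψ hψ' h
    exact Or.inr ⟨C.pos_add φ hφ ψ ψ.2 h, c, hc, by rw [hc', map_smul, ← hι]⟩
  · refine Or.inl ⟨?_, h⟩
    rw [C.bracket_zero φ hφ' ψ hψ' h fun h0 =>
      pos_ne_neg hφ ψ.2 (eq_neg_of_add_eq_zero_left h0), map_zero]

lemma exists_monomial_cascade
    (hι : ∀ φ : C.Pos, ι (C.e φ) = X φ)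
    (hDn : ∀ v ∈ C.nSub, ∀ w ∈ C.nSub, Dn v (ι w) = ι ⁅v, w⁆)
    {f : MvPolynomial (↥C.Pos) ℂ} (hf0 : f ≠ 0)
    (hf : ∀ v ∈ C.nSub, Dn v f = 0) :
    ∃ m ∈ f.support, ∀ φ : C.Pos, (φ : V) ∉ C.toRootSystemData.cascade → m φ = 0 := by
  refine exists_monomial_supported hf0 {φ | (φ : V) ∈ C.toRootSystemData.cascade} fun ψ hψ => ?_
  obtain ⟨φ, hφ, hc, huniq⟩ := exists_unique_add_mem_cascade ψ.2 hψ
  refine ⟨Dn (C.e φ), hf _ (e_mem_nSub hφ), ?_, fun ψ' hne => ?_⟩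
  · rcases dn_X hι hDn hφ ψ with h | ⟨h, c, hc0, hc'⟩
    · exact absurd (C.pos_subset (cascade_subset_pos hc)) h.2
    · exact ⟨_, hc, c, hc0, hc'⟩
  · rcases dn_X hι hDn hφ ψ' with h | ⟨h, c, -, hc'⟩
    · exact Or.inl h.1
    · exact Or.inr ⟨_, fun h' => hne (Subtype.ext (huniq ψ' ψ'.2 h')), c, hc'⟩

lemma weight_eq
    (hι : ∀ φ : C.Pos, ι (C.e φ) = X φ)
    (hDh : ∀ x : C.H, ∀ w ∈ C.nSub, Dh x (ι w) = ι ⁅(x : L), w⁆)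
    {f : MvPolynomial (↥C.Pos) ℂ} {ν : V} (hf : ∀ x : C.H, Dh x f = C.wt ν x • f)
    {m : C.Pos →₀ ℕ} (hm : coeff m f ≠ 0) : Finsupp.weight (fun φ : C.Pos => (φ : V)) m = ν := by
  refine C.wt_inj (LinearMap.ext fun x => ?_)
  have h1 : ∀ φ : C.Pos, Dh x (X φ) = C.wt φ x • X φ := by
    intro φ
    rw [← hι, hDh x _ (e_mem_nSub φ.2), C.root_vec x φ (C.pos_subset φ.2), map_smul]
  have h2 := coeff_derivation_of_diagonal h1 f m
  rw [hf, coeff_smul, smul_eq_mul] at h2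
  rw [mul_right_cancel₀ hm h2]
  exact map_finsuppWeight _ ((LinearMap.toAddMonoidHom
    (LinearMap.applyₗ (R := ℂ) (M₂ := ℂ) x)).comp C.wt.toAddMonoidHom) m

lemma eq_of_weight_eq {m m' : C.Pos →₀ ℕ}
    (hm : ∀ φ : C.Pos, (φ : V) ∉ C.toRootSystemData.cascade → m φ = 0)
    (hm' : ∀ φ : C.Pos, (φ : V) ∉ C.toRootSystemData.cascade → m' φ = 0)
    (h : Finsupp.weight (fun φ : C.Pos => (φ : V)) m =
      Finsupp.weight (fun φ : C.Pos => (φ : V)) m') : m = m' := by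
  have := Fintype.ofFinite C.Pos
  ext φ
  by_cases hφ : (φ : V) ∈ C.toRootSystemData.cascade
  swap
  · rw [hm φ hφ, hm' φ hφ]
  have key : ∀ n : C.Pos →₀ ℕ, (∀ φ : C.Pos, (φ : V) ∉ C.toRootSystemData.cascade → n φ = 0) →
      ⟪Finsupp.weight (fun φ : C.Pos => (φ : V)) n, (φ : V)⟫_ℝ = n φ * ⟪(φ : V), (φ : V)⟫_ℝ := by
    intro n hn
    rw [Finsupp.weight_eq_sum, sum_inner, Finset.sum_eq_single φ]
    · rw [← Nat.cast_smul_eq_nsmul ℝ, real_inner_smul_left]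
    · intro ψ _ hne
      rw [← Nat.cast_smul_eq_nsmul ℝ, real_inner_smul_left]
      by_cases hψ : (ψ : V) ∈ C.toRootSystemData.cascade
      · rw [inner_cascade hψ hφ (Subtype.coe_injective.ne hne), mul_zero]
      · rw [hn ψ hψ, Nat.cast_zero, zero_mul]
    · simp
  have h1 := key m hm
  rw [h, key m' hm'] at h1
  exact_mod_cast (mul_right_cancel₀ (inner_self_pos (C.pos_subset φ.2)).ne' h1).symm

lemma exists_weight_eq_finsum {m : C.Pos →₀ ℕ}
    (hm : ∀ φ : C.Pos, (φ : V) ∉ C.toRootSystemData.cascade → m φ = 0) :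
    ∃ k : V → ℕ, Finsupp.weight (fun φ : C.Pos => (φ : V)) m =
      ∑ᶠ β ∈ C.toRootSystemData.cascade, (k β : ℝ) • β := by
  classical
  have := Fintype.ofFinite C.Pos
  let k : V → ℕ := fun β => if h : β ∈ C.Pos then m ⟨β, h⟩ else 0
  have hk : ∀ φ : C.Pos, k φ = m φ := fun φ => by simp [k]
  refine ⟨k, ?_⟩
  have h1 : ∑ᶠ β ∈ C.toRootSystemData.cascade, (k β : ℝ) • β = ∑ᶠ β ∈ C.Pos, (k β : ℝ) • β := by
    refine finsum_mem_inter_support_eq _ _ _ (Set.ext fun β => ?_)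
    simp only [Set.mem_inter_iff, Function.mem_support]
    refine ⟨fun h => ⟨cascade_subset_pos h.1, h.2⟩, fun h => ⟨?_, h.2⟩⟩
    by_contra hc
    refine h.2 ?_
    rw [hk ⟨β, h.1⟩, hm ⟨β, h.1⟩ hc, Nat.cast_zero, zero_smul]
  rw [h1, ← finsum_set_coe_eq_finsum_mem, finsum_eq_sum_of_fintype, Finsupp.weight_eq_sum]
  exact Finset.sum_congr rfl fun φ _ => by rw [hk, Nat.cast_smul_eq_nsmul]

end CascadeLieData

lemma RootSystemData.add_self_notMem {V : Type*} [NormedAddCommGroup V] [InnerProductSpace ℝ V]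
    {R : RootSystemData V} {α : V} (hα : α ∈ R.Δ) : α + α ∉ R.Δ := by
  intro h
  rw [← two_smul ℝ] at h
  rcases R.reduced α hα 2 h with h | h <;> norm_num at h

namespace CascadeLieData

open MvPolynomial RootSystemData

variable {V : Type*} [NormedAddCommGroup V] [InnerProductSpace ℝ V]
  {L : Type*} [LieRing L] [LieAlgebra ℂ L] {C : CascadeLieData V L}

lemma bracket_neg_simple {α : V} (hα : α ∈ C.Simple) {φ : C.Pos} (hne : (φ : V) ≠ α) :
    ⁅C.e (-α), C.e φ⁆ = 0 ∨ ∃ _ : (φ : V) - α ∈ C.Pos, (φ : V) - α ≠ α ∧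
      ∃ c : ℂ, ⁅C.e (-α), C.e φ⁆ = c • C.e (φ - α) := by
  have hα' := C.pos_subset hα.1
  have hφ := C.pos_subset φ.2
  obtain ⟨c, hc, hc'⟩ := C.exists_bracket (C.neg_mem α hα') hφ
    (by rwa [neg_add_eq_sub, sub_ne_zero])
  rw [neg_add_eq_sub] at hc hc'
  by_cases h : (φ : V) - α ∈ C.Δ
  · refine Or.inr ⟨sub_simple_mem_pos hα φ.2 h, fun h' => ?_, c, hc⟩
    rw [sub_eq_iff_eq_add] at h'
    exact add_self_notMem hα' (h' ▸ hφ)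
  · exact Or.inl (by rw [hc, hc' h, zero_smul])

open Classical in
/-- The weight of a variable, refined by whether it is the variable of `e_α`. -/
noncomputable def stringWeight (C : CascadeLieData V L) (α : V) (φ : C.Pos) : V × ℤ :=
  (φ, if (φ : V) = α then 1 else 0)

lemma stringWeight_of_ne {α : V} {φ : C.Pos} (h : (φ : V) ≠ α) :
    C.stringWeight α φ = (↑φ, 0) := by
  rw [stringWeight, if_neg h]

lemma stringWeight_of_eq {α : V} {φ : C.Pos} (h : (φ : V) = α) :
    C.stringWeight α φ = (α, 1) := by
  rw [stringWeight, if_pos h, h]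

/-- The eigenvalue by which `⁅e_α, e_{-α}⁆`, suitably normalized, acts on polynomials of a given
`stringWeight`. -/
noncomputable def stringEigenvalue (α : V) : V × ℤ →+ ℂ where
  toFun p := ((2 * ⟪p.1 - (p.2 : ℝ) • α, α⟫_ℝ / ⟪α, α⟫_ℝ : ℝ) : ℂ)
  map_zero' := by simp
  map_add' p q := by
    simp only [Prod.fst_add, Prod.snd_add, inner_sub_left, inner_add_left, real_inner_smul_left]
    push_cast
    ring

lemma stringEigenvalue_apply (α : V) (p : V × ℤ) :
    stringEigenvalue α p = ((2 * ⟪p.1 - (p.2 : ℝ) • α, α⟫_ℝ / ⟪α, α⟫_ℝ : ℝ) : ℂ) := rfl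

open Classical in
/-- The derivation extending a multiple of `ad e_{-α}` on the variables other than that of `e_α`,
which it kills. -/
noncomputable def lowering (ι : L →ₗ[ℂ] MvPolynomial (↥C.Pos) ℂ) {α : V} (hα : α ∈ C.Δ) :
    Derivation ℂ (MvPolynomial (↥C.Pos) ℂ) (MvPolynomial (↥C.Pos) ℂ) :=
  mkDerivation ℂ fun φ : C.Pos => if (φ : V) = α then 0 else
    (2 / C.wt α (C.corootVec hα)) • ι ⁅C.e (-α), C.e φ⁆

lemma lowering_X_of_eq (ι : L →ₗ[ℂ] MvPolynomial (↥C.Pos) ℂ) {α : V} (hα : α ∈ C.Δ) {φ : C.Pos}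
    (h : (φ : V) = α) : lowering ι hα (X φ) = 0 := by
  rw [lowering, mkDerivation_X, if_pos h]

lemma lowering_X_of_ne (ι : L →ₗ[ℂ] MvPolynomial (↥C.Pos) ℂ) {α : V} (hα : α ∈ C.Δ) {φ : C.Pos}
    (h : (φ : V) ≠ α) :
    lowering ι hα (X φ) = (2 / C.wt α (C.corootVec hα)) • ι ⁅C.e (-α), C.e φ⁆ := by
  rw [lowering, mkDerivation_X, if_neg h]

variable {ι : L →ₗ[ℂ] MvPolynomial (↥C.Pos) ℂ}
  {Dn : L → Derivation ℂ (MvPolynomial (↥C.Pos) ℂ) (MvPolynomial (↥C.Pos) ℂ)}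
  {Dh : C.H → Derivation ℂ (MvPolynomial (↥C.Pos) ℂ) (MvPolynomial (↥C.Pos) ℂ)}

lemma isWeightedHomogeneous_lowering
    (hι : ∀ φ : C.Pos, ι (C.e φ) = X φ)
    {α : V} (hα : α ∈ C.Simple) (φ : C.Pos) :
    IsWeightedHomogeneous (C.stringWeight α) (lowering ι (C.pos_subset hα.1) (X φ))
      (C.stringWeight α φ + (-α, 0)) := by
  by_cases hne : (φ : V) = α
  · rw [lowering_X_of_eq ι _ hne]
    exact isWeightedHomogeneous_zero ..
  rw [lowering_X_of_ne ι _ hne, stringWeight_of_ne hne]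
  rcases bracket_neg_simple hα hne with h | ⟨h, h', c, hc⟩
  · rw [h, map_zero, smul_zero]
    exact isWeightedHomogeneous_zero ..
  · have h1 : ι (C.e (φ - α)) = X ⟨φ - α, h⟩ := hι ⟨φ - α, h⟩
    have h2 := isWeightedHomogeneous_X ℂ (C.stringWeight α) ⟨φ - α, h⟩
    rw [stringWeight_of_ne h'] at h2
    rw [hc, map_smul, h1, Prod.mk_add_mk, ← sub_eq_add_neg, add_zero,
      ← mem_weightedHomogeneousSubmodule ℂ]
    exact Submodule.smul_mem _ _ (Submodule.smul_mem _ _ h2)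

lemma isWeightedHomogeneous_raising
    (hι : ∀ φ : C.Pos, ι (C.e φ) = X φ)
    (hDn : ∀ v ∈ C.nSub, ∀ w ∈ C.nSub, Dn v (ι w) = ι ⁅v, w⁆)
    {α : V} (hα : α ∈ C.Pos) (φ : C.Pos) :
    IsWeightedHomogeneous (C.stringWeight α) (Dn (C.e α) (X φ))
      (C.stringWeight α φ + (α, 0)) := by
  rcases dn_X hι hDn hα φ with h | ⟨h, c, -, hc⟩
  · rw [h.1]
    exact isWeightedHomogeneous_zero ..
  have hne : (φ : V) ≠ α := fun h' => add_self_notMem (C.pos_subset hα) (by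
    simpa [h'] using C.pos_subset h)
  have hne' : α + φ ≠ α := fun h' => ne_zero (C.pos_subset φ.2) (by simpa using h')
  have h2 := isWeightedHomogeneous_X ℂ (C.stringWeight α) ⟨α + φ, h⟩
  rw [stringWeight_of_ne hne'] at h2
  rw [hc, stringWeight_of_ne hne, Prod.mk_add_mk, add_zero, add_comm (φ : V),
    ← mem_weightedHomogeneousSubmodule ℂ]
  exact Submodule.smul_mem _ _ h2

lemma commutator_X
    (hι : ∀ φ : C.Pos, ι (C.e φ) = X φ)
    (hDn : ∀ v ∈ C.nSub, ∀ w ∈ C.nSub, Dn v (ι w) = ι ⁅v, w⁆)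
    {α : V} (hα : α ∈ C.Simple) (φ : C.Pos) :
    ⁅Dn (C.e α), lowering ι (C.pos_subset hα.1)⁆ (X φ) =
      stringEigenvalue α (C.stringWeight α φ) • X φ := by
  have hα' := C.pos_subset hα.1
  have hφ := C.pos_subset φ.2
  have h0 := (inner_self_pos hα').ne'
  rw [Derivation.commutator_apply]
  by_cases hne : (φ : V) = α
  · rw [lowering_X_of_eq ι _ hne, map_zero, stringWeight_of_eq hne, stringEigenvalue_apply]
    rcases dn_X hι hDn hα.1 φ with h | ⟨h, -⟩
    · simp [h.1]
    · exact absurd (C.pos_subset h) (by rw [hne]; exact add_self_notMem hα')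
  have hmem : ⁅C.e (-α), C.e φ⁆ ∈ C.nSub := by
    rcases bracket_neg_simple hα hne with h | ⟨h, -, c, hc⟩
    · rw [h]; exact Submodule.zero_mem _
    · rw [hc]; exact Submodule.smul_mem _ _ (e_mem_nSub h)
  have h1 : lowering ι hα' (ι ⁅C.e α, C.e φ⁆) =
      (2 / C.wt α (C.corootVec hα')) • ι ⁅C.e (-α), ⁅C.e α, C.e φ⁆⁆ := by
    obtain ⟨c, hc, hc'⟩ := C.exists_bracket hα' hφ fun h =>
      pos_ne_neg hα.1 φ.2 (eq_neg_of_add_eq_zero_left h)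
    by_cases h : α + φ ∈ C.Δ
    · have hp := C.pos_add α hα.1 φ φ.2 h
      have h2 : ι (C.e (α + φ)) = X ⟨α + φ, hp⟩ := hι ⟨α + φ, hp⟩
      rw [hc, map_smul, h2, Derivation.map_smul, lowering_X_of_ne ι _ (by
        simpa using ne_zero hφ), lie_smul, map_smul, smul_comm]
    · rw [hc, hc' h, zero_smul, lie_zero, map_zero, map_zero, smul_zero]
  rw [lowering_X_of_ne ι _ hne, Derivation.map_smul, hDn _ (e_mem_nSub hα.1) _ hmem, ← hι φ,
    hDn _ (e_mem_nSub hα.1) _ (e_mem_nSub φ.2), h1, ← smul_sub, ← map_sub,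
    ← C.corootVec_bracket hα', C.root_vec _ _ hφ, map_smul, smul_smul, stringWeight_of_ne hne,
    stringEigenvalue_apply]
  congr 1
  have h2 := C.wt_corootVec hα' hφ
  have h3 := C.wt_corootVec_self_ne_zero hα'
  have h4 : ((⟪α, α⟫_ℝ : ℝ) : ℂ) ≠ 0 := by exact_mod_cast h0
  rw [Int.cast_zero, zero_smul, sub_zero]
  push_cast
  field_simp
  linear_combination h2

lemma commutator_apply
    (hι : ∀ φ : C.Pos, ι (C.e φ) = X φ)
    (hDn : ∀ v ∈ C.nSub, ∀ w ∈ C.nSub, Dn v (ι w) = ι ⁅v, w⁆)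
    {α : V} (hα : α ∈ C.Simple) {p : MvPolynomial (↥C.Pos) ℂ} {n : V × ℤ}
    (hp : IsWeightedHomogeneous (C.stringWeight α) p n) :
    ⁅Dn (C.e α), lowering ι (C.pos_subset hα.1)⁆ p = stringEigenvalue α n • p := by
  ext m
  rw [coeff_derivation_of_diagonal (commutator_X hι hDn hα), coeff_smul, smul_eq_mul]
  by_cases h : coeff m p = 0
  · rw [h, mul_zero, mul_zero]
  · rw [← hp h, map_finsuppWeight]

lemma fst_weight_stringWeight (α : V) (m : C.Pos →₀ ℕ) :
    (Finsupp.weight (C.stringWeight α) m).1 = Finsupp.weight (fun φ : C.Pos => (φ : V)) m :=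
  map_finsuppWeight _ (AddMonoidHom.fst V ℤ) m

lemma snd_weight_stringWeight_nonneg (α : V) (m : C.Pos →₀ ℕ) :
    0 ≤ (Finsupp.weight (C.stringWeight α) m).2 := by
  have h := map_finsuppWeight (C.stringWeight α) (AddMonoidHom.snd V ℤ) m
  rw [AddMonoidHom.coe_snd] at h
  rw [h, Finsupp.weight_apply]
  refine Finset.sum_nonneg fun φ _ => nsmul_nonneg ?_ _
  simp only [stringWeight]
  split_ifs <;> norm_num

/-- Polynomials only have weights on which a strictly dominant functional is nonnegative. -/
lemma inner_weight_nonneg {ρ : V} (hρ : ∀ α ∈ C.Simple, 0 < ⟪ρ, α⟫_ℝ) (m : C.Pos →₀ ℕ) :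
    0 ≤ ⟪ρ, Finsupp.weight (fun φ : C.Pos => (φ : V)) m⟫_ℝ := by
  rw [Finsupp.weight_apply, Finsupp.sum, inner_sum]
  refine Finset.sum_nonneg fun φ _ => ?_
  rw [← Nat.cast_smul_eq_nsmul ℝ, real_inner_smul_right]
  exact mul_nonneg (Nat.cast_nonneg _) (inner_nonneg_of_simple_pos hρ φ.2)

/-- The weight of an invariant is dominant. -/
lemma inner_simple_nonneg
    (hι : ∀ φ : C.Pos, ι (C.e φ) = X φ)
    (hDn : ∀ v ∈ C.nSub, ∀ w ∈ C.nSub, Dn v (ι w) = ι ⁅v, w⁆)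
    (hDh : ∀ x : C.H, ∀ w ∈ C.nSub, Dh x (ι w) = ι ⁅(x : L), w⁆)
    {ν : V} {f : MvPolynomial (↥C.Pos) ℂ} (hn : ∀ v ∈ C.nSub, Dn v f = 0)
    (hh : ∀ x : C.H, Dh x f = C.wt ν x • f) (hf : f ≠ 0) {α : V} (hα : α ∈ C.Simple) :
    0 ≤ ⟪ν, α⟫_ℝ := by
  classical
  have hα' := C.pos_subset hα.1
  have h0 := inner_self_pos hα'
  obtain ⟨m, hm⟩ := ne_zero_iff.1 hf
  set w := C.stringWeight α with hw
  set F := lowering ι hα' with hF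
  set i := (Finsupp.weight w m).2 with hi
  have hwm : Finsupp.weight w m = (ν, i) :=
    Prod.ext ((fst_weight_stringWeight α m).trans (weight_eq hι hDh hh hm)) rfl
  set g := weightedHomogeneousComponent w (ν, i) f with hgdef
  have hg : g ≠ 0 := by
    refine ne_zero_iff.2 ⟨m, ?_⟩
    rwa [hgdef, coeff_weightedHomogeneousComponent, if_pos hwm]
  have hEg : Dn (C.e α) g = 0 := by
    rw [hgdef, derivation_weightedHomogeneousComponent
      (isWeightedHomogeneous_raising hι hDn hα.1), hn _ (e_mem_nSub hα.1), map_zero]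
  have hFg : ∀ k : ℕ, IsWeightedHomogeneous w (F^[k] g) (ν - (k : ℝ) • α, i) := by
    intro k
    induction k with
    | zero =>
      rw [Nat.cast_zero, zero_smul, sub_zero]
      exact weightedHomogeneousComponent_isWeightedHomogeneous ..
    | succ k ih =>
      rw [Function.iterate_succ_apply']
      have h1 := isWeightedHomogeneous_derivation (isWeightedHomogeneous_lowering hι hα) ih
      rwa [Prod.mk_add_mk, add_zero, ← sub_eq_add_neg, sub_sub,
        show (k : ℝ) • α + α = ((k + 1 : ℕ) : ℝ) • α by push_cast; module] at h1
  have hnil : ∃ N, F^[N] g = 0 := by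
    obtain ⟨ρ, hρ⟩ := exists_simple_pos (R := C.toRootSystemData)
    obtain ⟨N, hN⟩ := exists_nat_gt (⟪ρ, ν⟫_ℝ / ⟪ρ, α⟫_ℝ)
    refine ⟨N, by_contra fun hne => ?_⟩
    obtain ⟨m', hm'⟩ := ne_zero_iff.1 hne
    have h1 := inner_weight_nonneg hρ m'
    rw [← fst_weight_stringWeight α, hFg N hm', inner_sub_right, real_inner_smul_right] at h1
    rw [div_lt_iff₀ (hρ α hα)] at hN
    linarith
  obtain ⟨k, hk⟩ := exists_nat_of_primitive (Dn (C.e α)).toLinearMap F.toLinearMap hg hEg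
    (a := stringEigenvalue α (ν, i)) (fun k => by
      have h1 := commutator_apply hι hDn hα (hFg k)
      rw [Derivation.commutator_apply] at h1
      refine h1.trans ?_
      congr 1
      simp only [stringEigenvalue_apply, inner_sub_left, real_inner_smul_left]
      have h4 : ((⟪α, α⟫_ℝ : ℝ) : ℂ) ≠ 0 := by exact_mod_cast h0.ne'
      push_cast
      field_simp
      ring) hnil
  rw [stringEigenvalue_apply] at hk
  have hk' : 2 * ⟪ν - (i : ℝ) • α, α⟫_ℝ / ⟪α, α⟫_ℝ = k := by exact_mod_cast hk
  rw [div_eq_iff h0.ne', inner_sub_left, real_inner_smul_left] at hk'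
  have h5 : (0 : ℝ) ≤ k * ⟪α, α⟫_ℝ := by positivity
  have h6 : (0 : ℝ) ≤ i * ⟪α, α⟫_ℝ :=
    mul_nonneg (by exact_mod_cast snd_weight_stringWeight_nonneg α m) h0.le
  linarith

end CascadeLieData
/-- Identify `S(𝔫)` with the polynomial ring on the basis
`{e_φ : φ ∈ Δ₊}` via a linear embedding `ι` with `ι (e_φ) = X_φ`, and let `Dn v` (`v ∈ 𝔫`)
and `Dh x` (`x ∈ 𝔥`) be the derivations of `S(𝔫)` extending `ad v` and `ad x`.  Then every
`𝔥`-weight occurring in `S(𝔫)^𝔫` occurs with multiplicity one, and every such weight `ν`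
is dominant and of the form `ν = Σ_{β∈ℬ} k_β β` with the `k_β` nonnegative integers. -/
theorem statement17 {V : Type*} [NormedAddCommGroup V] [InnerProductSpace ℝ V]
    {L : Type*} [LieRing L] [LieAlgebra ℂ L] [Module.Finite ℂ L]
    (C : CascadeLieData V L)
    (ι : L →ₗ[ℂ] MvPolynomial (↥C.Pos) ℂ)
    (hι : ∀ φ : ↥C.Pos, ι (C.e φ) = MvPolynomial.X φ)
    (Dn : L → Derivation ℂ (MvPolynomial (↥C.Pos) ℂ) (MvPolynomial (↥C.Pos) ℂ))
    (hDn : ∀ v ∈ C.nSub, ∀ w ∈ C.nSub, Dn v (ι w) = ι ⁅v, w⁆)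
    (Dh : C.H → Derivation ℂ (MvPolynomial (↥C.Pos) ℂ) (MvPolynomial (↥C.Pos) ℂ))
    (hDh : ∀ x : C.H, ∀ w ∈ C.nSub, Dh x (ι w) = ι ⁅(x : L), w⁆) :
    (∀ ν : V, ∀ f g : MvPolynomial (↥C.Pos) ℂ,
      (∀ v ∈ C.nSub, Dn v f = 0) → (∀ x : C.H, Dh x f = C.wt ν x • f) →
      (∀ v ∈ C.nSub, Dn v g = 0) → (∀ x : C.H, Dh x g = C.wt ν x • g) →
      f ≠ 0 → ∃ c : ℂ, g = c • f) ∧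
    (∀ ν : V, ∀ f : MvPolynomial (↥C.Pos) ℂ,
      (∀ v ∈ C.nSub, Dn v f = 0) → (∀ x : C.H, Dh x f = C.wt ν x • f) → f ≠ 0 →
      (∀ α ∈ C.toRootSystemData.Simple, 0 ≤ ⟪ν, α⟫_ℝ) ∧
      ∃ k : V → ℕ, ν = ∑ᶠ β ∈ C.toRootSystemData.cascade, (k β : ℝ) • β) := by
  refine ⟨fun ν f g hfn hfh hgn hgh hf => ?_, fun ν f hfn hfh hf => ⟨fun α hα =>
    CascadeLieData.inner_simple_nonneg hι hDn hDh hfn hfh hf hα, ?_⟩⟩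
  · obtain ⟨m, hm, hmc⟩ := CascadeLieData.exists_monomial_cascade hι hDn hf hfn
    have hm := MvPolynomial.mem_support_iff.1 hm
    set c := MvPolynomial.coeff m g / MvPolynomial.coeff m f with hc
    refine ⟨c, ?_⟩
    rw [← sub_eq_zero]
    by_contra hne
    have hn : ∀ v ∈ C.nSub, Dn v (g - c • f) = 0 := fun v hv => by
      rw [map_sub, Derivation.map_smul, hgn v hv, hfn v hv, smul_zero, sub_zero]
    have hh : ∀ x : C.H, Dh x (g - c • f) = C.wt ν x • (g - c • f) := fun x => by
      rw [map_sub, Derivation.map_smul, hgh, hfh, smul_sub, smul_comm]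
    obtain ⟨m', hm', hmc'⟩ := CascadeLieData.exists_monomial_cascade hι hDn hne hn
    have hm' := MvPolynomial.mem_support_iff.1 hm'
    obtain rfl := CascadeLieData.eq_of_weight_eq hmc hmc'
      ((CascadeLieData.weight_eq hι hDh hfh hm).trans
        (CascadeLieData.weight_eq hι hDh hh hm').symm)
    refine hm' ?_
    rw [MvPolynomial.coeff_sub, MvPolynomial.coeff_smul, smul_eq_mul, hc,
      div_mul_cancel₀ _ hm, sub_self]
  · obtain ⟨m, hm, hmc⟩ := CascadeLieData.exists_monomial_cascade hι hDn hf hfn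
    obtain ⟨k, hk⟩ := CascadeLieData.exists_weight_eq_finsum hmc
    exact ⟨k, (CascadeLieData.weight_eq hι hDh hfh
      (MvPolynomial.mem_support_iff.1 hm)).symm.trans hk⟩
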